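/- For every real p ≥ 2 and β > 0, the probability measure μ_p(dx) = e^{−β·d(x)^p} dx / ∫_{ℝ³} e^{−β·d(x)^p} dx on the Heisenberg group ℍ₁ satisfies a log-Sobolev inequality: there exists c > 0 such that μ_p(f² log(f²/μ_p(f²))) ≤ c · μ_p((X₁f)² + (X₂f)²) for all smooth compactly supported f: ℝ³ → ℝ. -/

import Mathlib

open MeasureTheory Filter

noncomputable section

/-- Action of the vector field with coefficient functions `a` on `f`:
`X f (x) = ∑ j a_j(x) ∂f/∂x_j (x)`. -/
def Xop {m : ℕ} (a : (Fin m → ℝ) → Fin m → ℝ) (f : (Fin m → ℝ) → ℝ) (x : Fin m → ℝ) : ℝ :=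
  ∑ j : Fin m, a x j * fderiv ℝ f x (Pi.single j 1)

/-- `‖∇f‖² = ∑ₖ (Xᵏ f)²` for the Hörmander system with coefficients `a`. -/
def gradSq {m n : ℕ} (a : Fin n → (Fin m → ℝ) → Fin m → ℝ) (f : (Fin m → ℝ) → ℝ)
    (x : Fin m → ℝ) : ℝ :=
  ∑ k : Fin n, Xop (a k) f x ^ 2

/-- The sublaplacian `Δf = ∑ₖ Xᵏ(Xᵏ f)`. -/
def subLap {m n : ℕ} (a : Fin n → (Fin m → ℝ) → Fin m → ℝ) (f : (Fin m → ℝ) → ℝ)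
    (x : Fin m → ℝ) : ℝ :=
  ∑ k : Fin n, Xop (a k) (Xop (a k) f) x

/-- Expectation of `f` under the probability measure `e^{-H(x)} dx / Z`. -/
def gibbsInt {m : ℕ} (H : (Fin m → ℝ) → ℝ) (f : (Fin m → ℝ) → ℝ) : ℝ :=
  (∫ x, f x * Real.exp (-H x)) / ∫ x, Real.exp (-H x)

/-- The Hörmander system `X₁ = ∂₁ - (x₂/2)∂₃`, `X₂ = ∂₂ + (x₁/2)∂₃` of the Heisenberg
group `ℍ₁ ≅ ℝ³`, given through its coefficient functions. -/
def heisA : Fin 2 → (Fin 3 → ℝ) → Fin 3 → ℝ :=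
  fun k x => if k = 0 then ![1, 0, -x 1 / 2] else ![0, 1, x 0 / 2]

/-- The Carnot–Carathéodory distance on `ℍ₁`: the infimum of lengths of admissible
(horizontal) Lipschitz curves joining `x` to `y`. -/
def ccDist (x y : Fin 3 → ℝ) : ℝ :=
  sInf {L : ℝ | ∃ (γ : ℝ → Fin 3 → ℝ) (cf : ℝ → Fin 2 → ℝ) (K : NNReal),
    LipschitzOnWith K γ (Set.Icc 0 1) ∧ γ 0 = x ∧ γ 1 = y ∧
    (∀ k, Measurable fun s => cf s k) ∧
    (∀ᵐ s ∂(volume.restrict (Set.Icc (0 : ℝ) 1)),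
      HasDerivAt γ (∑ k, cf s k • heisA k (γ s)) s) ∧
    L = ∫ s in Set.Icc (0 : ℝ) 1, Real.sqrt (∑ k, cf s k ^ 2)}

/-- Carnot–Carathéodory distance to the identity `e = 0` of `ℍ₁`. -/
def dH (x : Fin 3 → ℝ) : ℝ := ccDist x 0

/-- The set of lengths of horizontal curves joining `x` to `y`, so that `ccDist` is its infimum. -/
def ccLengths (x y : Fin 3 → ℝ) : Set ℝ :=
  {L : ℝ | ∃ (γ : ℝ → Fin 3 → ℝ) (cf : ℝ → Fin 2 → ℝ) (K : NNReal),
    LipschitzOnWith K γ (Set.Icc 0 1) ∧ γ 0 = x ∧ γ 1 = y ∧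
    (∀ k, Measurable fun s => cf s k) ∧
    (∀ᵐ s ∂(volume.restrict (Set.Icc (0 : ℝ) 1)),
      HasDerivAt γ (∑ k, cf s k • heisA k (γ s)) s) ∧
    L = ∫ s in Set.Icc (0 : ℝ) 1, Real.sqrt (∑ k, cf s k ^ 2)}

/-- Horizontal Lipschitz curves parametrised by `[a, b]`. -/
structure IsHorizontal (γ : ℝ → Fin 3 → ℝ) (cf : ℝ → Fin 2 → ℝ) (a b : ℝ) : Prop where
  lip : ∃ K : NNReal, LipschitzOnWith K γ (Set.Icc a b)
  meas : ∀ k, Measurable fun s => cf s k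
  deriv : ∀ᵐ s, s ∈ Set.Icc a b → HasDerivAt γ (∑ k, cf s k • heisA k (γ s)) s

/-- The speed of a horizontal curve with controls `cf`. -/
def hspeed (cf : ℝ → Fin 2 → ℝ) (s : ℝ) : ℝ := Real.sqrt (∑ k, cf s k ^ 2)

theorem hspeed_nonneg (cf : ℝ → Fin 2 → ℝ) (s : ℝ) : 0 ≤ hspeed cf s := Real.sqrt_nonneg _

theorem abs_le_hspeed (cf : ℝ → Fin 2 → ℝ) (s : ℝ) (k : Fin 2) : |cf s k| ≤ hspeed cf s := by
  apply Real.abs_le_sqrt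
  exact Finset.single_le_sum (f := fun k => cf s k ^ 2) (fun i _ => sq_nonneg _) (Finset.mem_univ k)

theorem hspeed_le (cf : ℝ → Fin 2 → ℝ) (s : ℝ) : hspeed cf s ≤ |cf s 0| + |cf s 1| := by
  apply Real.sqrt_le_iff.2 ⟨by positivity, ?_⟩
  rw [Fin.sum_univ_two, ← sq_abs (cf s 0), ← sq_abs (cf s 1)]
  nlinarith [abs_nonneg (cf s 0), abs_nonneg (cf s 1)]

theorem measurable_hspeed {cf : ℝ → Fin 2 → ℝ} (h : ∀ k, Measurable fun s => cf s k) :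
    Measurable (hspeed cf) := by
  unfold hspeed
  have h0 := h 0
  have h1 := h 1
  simp only [Fin.sum_univ_two]
  fun_prop

theorem heisA_sum_zero (c : Fin 2 → ℝ) (x : Fin 3 → ℝ) : (∑ k, c k • heisA k x) 0 = c 0 := by
  simp [heisA, Fin.sum_univ_two]

theorem heisA_sum_one (c : Fin 2 → ℝ) (x : Fin 3 → ℝ) : (∑ k, c k • heisA k x) 1 = c 1 := by
  simp [heisA, Fin.sum_univ_two]

theorem heisA_sum_two (c : Fin 2 → ℝ) (x : Fin 3 → ℝ) :
    (∑ k, c k • heisA k x) 2 = (x 0 * c 1 - x 1 * c 0) / 2 := by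
  simp [heisA, Fin.sum_univ_two]
  ring

namespace IsHorizontal

variable {γ : ℝ → Fin 3 → ℝ} {cf : ℝ → Fin 2 → ℝ} {a b : ℝ}

theorem mono (h : IsHorizontal γ cf a b) {a' b' : ℝ} (ha : a ≤ a') (hb : b' ≤ b) :
    IsHorizontal γ cf a' b' := by
  obtain ⟨K, hK⟩ := h.lip
  refine ⟨⟨K, hK.mono (Set.Icc_subset_Icc ha hb)⟩, h.meas, ?_⟩
  filter_upwards [h.deriv] with s hs hs'
  exact hs (Set.Icc_subset_Icc ha hb hs')

theorem intervalIntegrable_hspeed (h : IsHorizontal γ cf a b) (hab : a ≤ b) :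
    IntervalIntegrable (hspeed cf) volume a b := by
  obtain ⟨K, hK⟩ := h.lip
  rw [intervalIntegrable_iff_integrableOn_Ioo_of_le hab]
  refine Measure.integrableOn_of_bounded (M := K + K) (by simp)
    (measurable_hspeed h.meas).aestronglyMeasurable ?_
  rw [ae_restrict_iff' measurableSet_Ioo]
  filter_upwards [h.deriv] with s hs hs'
  have h1 := (hs (Set.Ioo_subset_Icc_self hs')).le_of_lipschitzOn (Icc_mem_nhds hs'.1 hs'.2) hK
  have h2 : ∀ i, ‖(∑ k, cf s k • heisA k (γ s)) i‖ ≤ K := fun i => (norm_le_pi_norm _ i).trans h1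
  have h3 := h2 0
  have h4 := h2 1
  rw [heisA_sum_zero, Real.norm_eq_abs] at h3
  rw [heisA_sum_one, Real.norm_eq_abs] at h4
  rw [Real.norm_eq_abs, abs_of_nonneg (hspeed_nonneg _ _)]
  linarith [hspeed_le cf s]

theorem length_mem (h : IsHorizontal γ cf a b) (hab : a < b) :
    (∫ s in a..b, hspeed cf s) ∈ ccLengths (γ a) (γ b) := by
  obtain ⟨K, hK⟩ := h.lip
  have hpos : 0 < b - a := sub_pos.2 hab
  have hmap : Set.MapsTo (fun u : ℝ => (b - a) * u + a) (Set.Icc 0 1) (Set.Icc a b) := by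
    intro u hu
    constructor <;> nlinarith [hu.1, hu.2]
  have hl : LipschitzOnWith (Real.toNNReal (b - a)) (fun u : ℝ => (b - a) * u + a)
      (Set.Icc 0 1) := by
    refine LipschitzOnWith.of_dist_le_mul fun x _ y _ => ?_
    rw [Real.dist_eq, Real.dist_eq, Real.coe_toNNReal _ hpos.le]
    rw [show (b - a) * x + a - ((b - a) * y + a) = (b - a) * (x - y) by ring, abs_mul,
      abs_of_pos hpos]
  refine ⟨fun u => γ ((b - a) * u + a), fun u k => (b - a) * cf ((b - a) * u + a) k,
    K * Real.toNNReal (b - a), hK.comp hl hmap, by simp, by simp, ?_, ?_, ?_⟩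
  · intro k
    exact ((h.meas k).comp (by fun_prop : Measurable fun u : ℝ => (b - a) * u + a)).const_mul _
  · rw [ae_restrict_iff' measurableSet_Icc]
    have hq : Measure.QuasiMeasurePreserving (fun u : ℝ => (b - a) * u + a) volume volume := by
      refine (measurePreserving_add_right volume a).quasiMeasurePreserving.comp
        (g := fun u => u + a) (f := fun u => (b - a) * u) ⟨by fun_prop, ?_⟩
      rw [Real.map_volume_mul_left hpos.ne']
      exact Measure.smul_absolutelyContinuous
    filter_upwards [hq.ae h.deriv] with u hu hu'
    have h1 : HasDerivAt (fun u : ℝ => (b - a) * u + a) (b - a) u := by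
      simpa using ((hasDerivAt_id u).const_mul (b - a)).add_const a
    have h2 := HasDerivAt.scomp u (hu (hmap hu')) h1
    simp only [Finset.smul_sum, smul_smul] at h2
    exact h2
  · rw [integral_Icc_eq_integral_Ioc, ← intervalIntegral.integral_of_le zero_le_one]
    have : ∀ u : ℝ, Real.sqrt (∑ k, ((b - a) * cf ((b - a) * u + a) k) ^ 2)
        = (b - a) * hspeed cf ((b - a) * u + a) := by
      intro u
      simp only [mul_pow, ← Finset.mul_sum, hspeed]
      rw [Real.sqrt_mul (sq_nonneg _), Real.sqrt_sq hpos.le]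
    simp only [this]
    rw [intervalIntegral.integral_const_mul,
      intervalIntegral.integral_comp_mul_add (fun x => hspeed cf x) hpos.ne']
    simp only [smul_eq_mul, mul_zero, zero_add, mul_one, sub_add_cancel]
    field_simp

end IsHorizontal

theorem exists_isHorizontal_of_mem_ccLengths {x y : Fin 3 → ℝ} {L : ℝ} (h : L ∈ ccLengths x y) :
    ∃ γ cf, IsHorizontal γ cf 0 1 ∧ γ 0 = x ∧ γ 1 = y ∧ L = ∫ s in (0 : ℝ)..1, hspeed cf s := by
  obtain ⟨γ, cf, K, hK, h0, h1, hm, hd, hL⟩ := h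
  rw [ae_restrict_iff' measurableSet_Icc] at hd
  refine ⟨γ, cf, ⟨⟨K, hK⟩, hm, hd⟩, h0, h1, ?_⟩
  rw [intervalIntegral.integral_of_le zero_le_one, ← integral_Icc_eq_integral_Ioc]
  exact hL

theorem abs_sub_le_of_ae_hasDerivAt {h h' g : ℝ → ℝ} {a b : ℝ} (hab : a ≤ b)
    (hac : AbsolutelyContinuousOnInterval h a b)
    (hd : ∀ᵐ s, s ∈ Set.Icc a b → HasDerivAt h (h' s) s ∧ |h' s| ≤ g s)
    (hg : IntervalIntegrable g volume a b) : |h b - h a| ≤ ∫ s in a..b, g s := by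
  rw [← hac.integral_deriv_eq_sub, ← Real.norm_eq_abs]
  refine intervalIntegral.norm_integral_le_of_norm_le hab ?_ hg
  filter_upwards [hd] with s hs hs'
  obtain ⟨h1, h2⟩ := hs (Set.Ioc_subset_Icc_self hs')
  rw [h1.deriv]
  exact h2

/-- The Heisenberg group law. -/
def hmul (x y : Fin 3 → ℝ) : Fin 3 → ℝ :=
  ![x 0 + y 0, x 1 + y 1, x 2 + y 2 + (x 0 * y 1 - x 1 * y 0) / 2]

/-- Anisotropic boxes around the identity. -/
def hbox (r : ℝ) : Set (Fin 3 → ℝ) := {g | |g 0| ≤ r ∧ |g 1| ≤ r ∧ |g 2| ≤ r ^ 2}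

/-- The left quotient `x⁻¹ y`. -/
def hdiv (x y : Fin 3 → ℝ) : Fin 3 → ℝ :=
  ![y 0 - x 0, y 1 - x 1, y 2 - x 2 - (x 0 * y 1 - x 1 * y 0) / 2]

@[simp] theorem hmul_zero' (x y : Fin 3 → ℝ) : hmul x y 0 = x 0 + y 0 := rfl
@[simp] theorem hmul_one' (x y : Fin 3 → ℝ) : hmul x y 1 = x 1 + y 1 := rfl
@[simp] theorem hmul_two' (x y : Fin 3 → ℝ) :
    hmul x y 2 = x 2 + y 2 + (x 0 * y 1 - x 1 * y 0) / 2 := rfl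
@[simp] theorem hdiv_zero' (x y : Fin 3 → ℝ) : hdiv x y 0 = y 0 - x 0 := rfl
@[simp] theorem hdiv_one' (x y : Fin 3 → ℝ) : hdiv x y 1 = y 1 - x 1 := rfl
@[simp] theorem hdiv_two' (x y : Fin 3 → ℝ) :
    hdiv x y 2 = y 2 - x 2 - (x 0 * y 1 - x 1 * y 0) / 2 := rfl

theorem hext {x y : Fin 3 → ℝ} (h0 : x 0 = y 0) (h1 : x 1 = y 1) (h2 : x 2 = y 2) : x = y := by
  funext i
  fin_cases i <;> assumption

theorem hmul_hdiv (x y : Fin 3 → ℝ) : hmul x (hdiv x y) = y :=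
  hext (by simp) (by simp) (by simp; ring)

theorem hdiv_hmul (x y : Fin 3 → ℝ) : hdiv x (hmul x y) = y :=
  hext (by simp) (by simp) (by simp; ring)

theorem hmul_assoc (x y z : Fin 3 → ℝ) : hmul (hmul x y) z = hmul x (hmul y z) :=
  hext (by simp; ring) (by simp; ring) (by simp; ring)

theorem hmul_zero_left (x : Fin 3 → ℝ) : hmul 0 x = x :=
  hext (by simp) (by simp) (by simp)

theorem IsHorizontal.hdiv_mem_hbox {γ : ℝ → Fin 3 → ℝ} {cf : ℝ → Fin 2 → ℝ} {a b : ℝ}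
    (h : IsHorizontal γ cf a b) (hab : a ≤ b) :
    hdiv (γ a) (γ b) ∈ hbox (∫ s in a..b, hspeed cf s) := by
  have hac : ∀ i : Fin 3, ∀ t, a ≤ t → t ≤ b →
      AbsolutelyContinuousOnInterval (fun s => γ s i) a t := by
    intro i t hta ht
    obtain ⟨K, hK⟩ := h.lip
    apply LipschitzOnWith.absolutelyContinuousOnInterval (K := K)
    rw [Set.uIcc_of_le hta]
    refine LipschitzOnWith.of_dist_le_mul fun x hx y hy => ?_
    exact (dist_le_pi_dist _ _ i).trans
      (hK.dist_le_mul x ⟨hx.1, hx.2.trans ht⟩ y ⟨hy.1, hy.2.trans ht⟩)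
  have hd : ∀ᵐ s, s ∈ Set.Icc a b → HasDerivAt (fun s => γ s 0) (cf s 0) s ∧
      HasDerivAt (fun s => γ s 1) (cf s 1) s ∧
      HasDerivAt (fun s => γ s 2) ((γ s 0 * cf s 1 - γ s 1 * cf s 0) / 2) s := by
    filter_upwards [h.deriv] with s hs hs'
    have := hasDerivAt_pi.1 (hs hs')
    exact ⟨heisA_sum_zero (cf s) (γ s) ▸ this 0, heisA_sum_one (cf s) (γ s) ▸ this 1,
      heisA_sum_two (cf s) (γ s) ▸ this 2⟩
  have hInt := h.intervalIntegrable_hspeed hab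
  set ℓ := ∫ s in a..b, hspeed cf s with hℓ
  have hmonoI : ∀ t, a ≤ t → t ≤ b → ∫ s in a..t, hspeed cf s ≤ ℓ := by
    intro t h1 h2
    exact intervalIntegral.integral_mono_interval le_rfl h1 h2
      (Eventually.of_forall (hspeed_nonneg cf)) hInt
  have hInt' : ∀ t, a ≤ t → t ≤ b → IntervalIntegrable (hspeed cf) volume a t :=
    fun t h1 h2 => (h.mono le_rfl h2).intervalIntegrable_hspeed h1
  have hb0 : ∀ t, a ≤ t → t ≤ b → |γ t 0 - γ a 0| ≤ ℓ := by
    intro t h1 h2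
    refine (abs_sub_le_of_ae_hasDerivAt h1 (hac 0 t h1 h2) (h' := fun s => cf s 0) ?_
      (hInt' t h1 h2)).trans (hmonoI t h1 h2)
    filter_upwards [hd] with s hs hs'
    exact ⟨(hs ⟨hs'.1, hs'.2.trans h2⟩).1, abs_le_hspeed cf s 0⟩
  have hb1 : ∀ t, a ≤ t → t ≤ b → |γ t 1 - γ a 1| ≤ ℓ := by
    intro t h1 h2
    refine (abs_sub_le_of_ae_hasDerivAt h1 (hac 1 t h1 h2) (h' := fun s => cf s 1) ?_
      (hInt' t h1 h2)).trans (hmonoI t h1 h2)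
    filter_upwards [hd] with s hs hs'
    exact ⟨(hs ⟨hs'.1, hs'.2.trans h2⟩).2.1, abs_le_hspeed cf s 1⟩
  refine ⟨hb0 b hab le_rfl, hb1 b hab le_rfl, ?_⟩
  have key := abs_sub_le_of_ae_hasDerivAt (a := a) (b := b)
    (h := fun s => γ s 2 + (-(γ a 0 / 2)) * γ s 1 + (γ a 1 / 2) * γ s 0)
    (h' := fun s => ((γ s 0 - γ a 0) * cf s 1 - (γ s 1 - γ a 1) * cf s 0) / 2)
    (g := fun s => ℓ * hspeed cf s) hab
    (((hac 2 b hab le_rfl).add ((hac 1 b hab le_rfl).const_mul _)).add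
      ((hac 0 b hab le_rfl).const_mul _)) ?_ (hInt.const_mul ℓ)
  · rw [intervalIntegral.integral_const_mul] at key
    rw [hdiv_two', sq]
    refine le_of_eq_of_le (congrArg _ ?_) key
    ring
  · filter_upwards [hd] with s hs hs'
    obtain ⟨h0, h1, h2⟩ := hs hs'
    constructor
    · refine ((h2.add (h1.const_mul (-(γ a 0 / 2)))).add (h0.const_mul (γ a 1 / 2))).congr_deriv ?_
      ring
    · have e0 := hb0 s hs'.1 hs'.2
      have e1 := hb1 s hs'.1 hs'.2
      have f0 := abs_le_hspeed cf s 0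
      have f1 := abs_le_hspeed cf s 1
      rw [abs_div, abs_two]
      have g1 : |(γ s 0 - γ a 0) * cf s 1| ≤ ℓ * hspeed cf s := by
        rw [abs_mul]; exact mul_le_mul e0 f1 (abs_nonneg _) ((abs_nonneg _).trans e0)
      have g2 : |(γ s 1 - γ a 1) * cf s 0| ≤ ℓ * hspeed cf s := by
        rw [abs_mul]; exact mul_le_mul e1 f0 (abs_nonneg _) ((abs_nonneg _).trans e0)
      have g3 := abs_sub ((γ s 0 - γ a 0) * cf s 1) ((γ s 1 - γ a 1) * cf s 0)
      linarith

theorem IsHorizontal.concat {γ₁ γ₂ : ℝ → Fin 3 → ℝ} {c₁ c₂ : ℝ → Fin 2 → ℝ} {a b c : ℝ}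
    (h₁ : IsHorizontal γ₁ c₁ a b) (h₂ : IsHorizontal γ₂ c₂ b c) (hab : a ≤ b) (hbc : b ≤ c)
    (hb : γ₁ b = γ₂ b) :
    IsHorizontal (fun u => if u ≤ b then γ₁ u else γ₂ u) (fun u => if u ≤ b then c₁ u else c₂ u)
      a c := by
  refine ⟨?_, ?_, ?_⟩
  · obtain ⟨K₁, hK₁⟩ := h₁.lip
    obtain ⟨K₂, hK₂⟩ := h₂.lip
    have hlt : ∀ x y, a ≤ x → x ≤ b → b < y → y ≤ c →
        dist (γ₁ x) (γ₂ y) ≤ (K₁ + K₂) * (y - x) := by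
      intro x y hax hxb hby hyc
      have e1 := hK₁.dist_le_mul x ⟨hax, hxb⟩ b ⟨hab, le_rfl⟩
      have e2 := hK₂.dist_le_mul b ⟨le_rfl, hbc⟩ y ⟨hby.le, hyc⟩
      rw [Real.dist_eq, abs_of_nonpos (by linarith)] at e1 e2
      have e3 := dist_triangle (γ₁ x) (γ₁ b) (γ₂ y)
      rw [hb] at e3 e1
      have k1 := K₁.2
      have k2 := K₂.2
      nlinarith [mul_nonneg k1 (by linarith : 0 ≤ y - b), mul_nonneg k2 (by linarith : 0 ≤ b - x)]
    refine ⟨K₁ + K₂, LipschitzOnWith.of_dist_le_mul fun x hx y hy => ?_⟩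
    have k1 := K₁.2
    have k2 := K₂.2
    have hd : 0 ≤ dist x y := dist_nonneg
    push_cast
    by_cases hxb : x ≤ b <;> by_cases hyb : y ≤ b <;> simp only [hxb, hyb, if_true, if_false]
    · exact (hK₁.dist_le_mul x ⟨hx.1, hxb⟩ y ⟨hy.1, hyb⟩).trans
        (mul_le_mul_of_nonneg_right (by simp) hd)
    · rw [Real.dist_eq, abs_of_nonpos (by linarith), neg_sub]
      exact hlt x y hx.1 hxb (not_le.1 hyb) hy.2
    · rw [Real.dist_eq, abs_of_nonneg (by linarith), dist_comm]
      exact hlt y x hy.1 hyb (not_le.1 hxb) hx.2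
    · exact (hK₂.dist_le_mul x ⟨(not_le.1 hxb).le, hx.2⟩ y ⟨(not_le.1 hyb).le, hy.2⟩).trans
        (mul_le_mul_of_nonneg_right (by simp) hd)
  · intro k
    simp only [apply_ite (fun v : Fin 2 → ℝ => v k)]
    exact Measurable.ite measurableSet_Iic (h₁.meas k) (h₂.meas k)
  · have hne : ∀ᵐ s : ℝ, s ≠ b := by simp [ae_iff]
    filter_upwards [h₁.deriv, h₂.deriv, hne] with s hs₁ hs₂ hsb hs
    rcases lt_or_gt_of_ne hsb with hlt | hgt
    · simp only [hlt.le, if_true]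
      refine (hs₁ ⟨hs.1, hlt.le⟩).congr_of_eventuallyEq ?_
      filter_upwards [Iio_mem_nhds hlt] with u hu
      simp [le_of_lt (Set.mem_Iio.1 hu)]
    · simp only [not_le.2 hgt, if_false]
      refine (hs₂ ⟨hgt.le, hs.2⟩).congr_of_eventuallyEq ?_
      filter_upwards [Ioi_mem_nhds hgt] with u hu
      simp [not_le.2 (Set.mem_Ioi.1 hu)]

/-- The one-parameter subgroups generated by the two horizontal vector fields. -/
def hseg (k : Fin 2) (t : ℝ) : Fin 3 → ℝ := if k = 0 then ![t, 0, 0] else ![0, t, 0]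

theorem hmul_hseg_neg (x : Fin 3 → ℝ) (k : Fin 2) (t : ℝ) :
    hmul (hmul x (hseg k t)) (hseg k (-t)) = x := by
  apply hext <;> fin_cases k <;> simp [hseg] <;> ring

theorem hasDerivAt_hmul_hseg (x : Fin 3 → ℝ) (k : Fin 2) (t : ℝ) :
    HasDerivAt (fun s => hmul x (hseg k s)) (heisA k (hmul x (hseg k t))) t := by
  rw [hasDerivAt_pi]
  intro i
  have h0 := hasDerivAt_id t
  have hc : ∀ c : ℝ, HasDerivAt (fun _ : ℝ => c) 0 t := fun c => hasDerivAt_const t c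
  fin_cases k <;> fin_cases i <;> simp [hseg, heisA]
  · exact h0.const_add (x 0)
  · exact hc _
  · exact ((h0.const_mul (x 1)).neg.div_const 2).congr_deriv (by ring)
  · exact hc _
  · exact h0.const_add (x 1)
  · exact ((h0.const_mul (x 0)).div_const 2).congr_deriv (by ring)

theorem isHorizontal_hseg (x : Fin 3 → ℝ) (k : Fin 2) (t : ℝ) :
    IsHorizontal (fun u => hmul x (hseg k (-u * t))) (fun _ => Pi.single k (-t)) (-1) 0 := by
  have hder : ∀ s, HasDerivAt (fun u => hmul x (hseg k (-u * t)))
      (∑ j, (Pi.single k (-t) : Fin 2 → ℝ) j • heisA j (hmul x (hseg k (-s * t)))) s := by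
    intro s
    have h1 : HasDerivAt (fun u : ℝ => -u * t) (-t) s := by
      simpa using (hasDerivAt_id s).neg.mul_const t
    refine (HasDerivAt.scomp s (hasDerivAt_hmul_hseg x k (-s * t)) h1).congr_deriv ?_
    fin_cases k <;> simp
  have hcd : ContDiff ℝ 1 (fun u => hmul x (hseg k (-u * t))) := by
    rw [contDiff_pi]
    intro i
    fin_cases k <;> fin_cases i <;> simp [hseg] <;> fun_prop
  refine ⟨?_, fun k => measurable_const, Eventually.of_forall fun s _ => hder s⟩
  exact hcd.contDiffOn.exists_lipschitzOnWith one_ne_zero (convex_Icc _ _) isCompact_Icc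

theorem add_abs_mem_ccLengths {x y : Fin 3 → ℝ} {L : ℝ} (h : L ∈ ccLengths x y) (k : Fin 2)
    (t : ℝ) : L + |t| ∈ ccLengths (hmul x (hseg k t)) y := by
  obtain ⟨γ, cf, hγ, h0, h1, hL⟩ := exists_isHorizontal_of_mem_ccLengths h
  have hs := isHorizontal_hseg x k t
  have hc := hs.concat hγ (by norm_num) zero_le_one (by
    simp only [neg_zero, zero_mul, h0]
    apply hext <;> fin_cases k <;> simp [hseg])
  have hm := hc.length_mem (by norm_num)
  have e0 : hspeed (fun _ => Pi.single k (-t) : ℝ → Fin 2 → ℝ) = fun _ => |t| := by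
    funext s
    fin_cases k <;> simp [hspeed, Real.sqrt_sq_eq_abs]
  have e1 : ∫ s in (-1 : ℝ)..0, hspeed (fun u => if u ≤ 0 then Pi.single k (-t) else cf u) s
      = |t| := by
    rw [intervalIntegral.integral_congr (g := fun _ => |t|)]
    · simp
    · intro s hs'
      rw [Set.uIcc_of_le (by norm_num)] at hs'
      have := congrFun e0 s
      simpa [hspeed, hs'.2] using this
  have e2 : ∫ s in (0 : ℝ)..1, hspeed (fun u => if u ≤ 0 then Pi.single k (-t) else cf u) s
      = L := by
    rw [hL]
    refine intervalIntegral.integral_congr_ae (Eventually.of_forall fun s hs' => ?_)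
    rw [Set.uIoc_of_le zero_le_one] at hs'
    simp [hspeed, not_le.2 hs'.1]
  rw [← intervalIntegral.integral_add_adjacent_intervals
    ((hc.mono le_rfl zero_le_one).intervalIntegrable_hspeed (by norm_num))
    ((hc.mono (by norm_num) le_rfl).intervalIntegrable_hspeed zero_le_one), e1, e2] at hm
  simp only [show (-1 : ℝ) ≤ 0 by norm_num, show ¬ (1 : ℝ) ≤ 0 by norm_num, if_true, if_false,
    neg_neg, one_mul, h1] at hm
  rwa [add_comm]

theorem zero_mem_ccLengths : (0 : ℝ) ∈ ccLengths 0 0 :=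
  ⟨fun _ => 0, fun _ => 0, 0, LipschitzWith.const 0 |>.lipschitzOnWith, rfl, rfl,
    fun _ => measurable_const, Eventually.of_forall fun s => by simpa using hasDerivAt_const s _,
    by simp⟩

theorem nonneg_of_mem_ccLengths {x y : Fin 3 → ℝ} {L : ℝ} (h : L ∈ ccLengths x y) : 0 ≤ L := by
  obtain ⟨_, _, _, _, _, _, _, _, rfl⟩ := h
  exact integral_nonneg fun _ => Real.sqrt_nonneg _

theorem exists_shorter {x y : Fin 3 → ℝ} {L ℓ : ℝ} (h : L ∈ ccLengths x y) (h0 : 0 ≤ ℓ)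
    (hL : ℓ < L) : ∃ g ∈ hbox ℓ, L - ℓ ∈ ccLengths (hmul x g) y := by
  obtain ⟨γ, cf, hγ, rfl, rfl, hL'⟩ := exists_isHorizontal_of_mem_ccLengths h
  have hInt := hγ.intervalIntegrable_hspeed zero_le_one
  have hcont := intervalIntegral.continuousOn_primitive_interval' hInt Set.left_mem_uIcc
  rw [Set.uIcc_of_le zero_le_one] at hcont
  obtain ⟨s, hs, hsl⟩ := intermediate_value_Icc zero_le_one hcont
    (show ℓ ∈ Set.Icc _ _ by simp only [intervalIntegral.integral_same, ← hL']; exact ⟨h0, hL.le⟩)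
  simp only at hsl
  have hs1 : s < 1 := by
    refine lt_of_le_of_ne hs.2 fun hs1 => ?_
    rw [hs1, ← hL'] at hsl
    exact hL.ne' hsl
  refine ⟨hdiv (γ 0) (γ s), hsl ▸ (hγ.mono le_rfl hs.2).hdiv_mem_hbox hs.1, ?_⟩
  rw [hmul_hdiv]
  have h2 := (hγ.mono hs.1 le_rfl).length_mem hs1
  have h3 := intervalIntegral.integral_add_adjacent_intervals
    ((hγ.mono le_rfl hs.2).intervalIntegrable_hspeed hs.1)
    ((hγ.mono hs.1 le_rfl).intervalIntegrable_hspeed hs.2)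
  rw [hsl, ← hL'] at h3
  rwa [← h3, add_sub_cancel_left]

theorem hdiv_mem_hbox_of_mem_ccLengths {x y : Fin 3 → ℝ} {L : ℝ} (h : L ∈ ccLengths x y) :
    hdiv x y ∈ hbox L := by
  obtain ⟨γ, cf, hγ, rfl, rfl, rfl⟩ := exists_isHorizontal_of_mem_ccLengths h
  exact hγ.hdiv_mem_hbox zero_le_one

/-- The endpoint of the broken horizontal line starting at `x` with successive segments `l`. -/
def hwalk (x : Fin 3 → ℝ) (l : List (Fin 2 × ℝ)) : Fin 3 → ℝ :=
  l.foldl (fun y p => hmul y (hseg p.1 p.2)) x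

@[simp] theorem hwalk_nil (x : Fin 3 → ℝ) : hwalk x [] = x := rfl

@[simp] theorem hwalk_cons (x : Fin 3 → ℝ) (p : Fin 2 × ℝ) (l : List (Fin 2 × ℝ)) :
    hwalk x (p :: l) = hwalk (hmul x (hseg p.1 p.2)) l := rfl

theorem exists_hwalk_eq_hmul {h : Fin 3 → ℝ} {ρ : ℝ} (hρ : 0 ≤ ρ) (hh : h ∈ hbox ρ) :
    ∃ l : List (Fin 2 × ℝ), l.length = 6 ∧ (∀ p ∈ l, |p.2| ≤ 2 * ρ) ∧
      ∀ x, hwalk x l = hmul x h := by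
  obtain ⟨h0, h1, h2⟩ := hh
  have hprod : |h 0 * h 1| ≤ ρ ^ 2 := by
    rw [abs_mul, sq]
    exact mul_le_mul h0 h1 (abs_nonneg _) hρ
  set c := h 2 - h 0 * h 1 / 2 with hc
  have hcb : |c| ≤ (2 * ρ) ^ 2 := by
    have := abs_sub (h 2) (h 0 * h 1 / 2)
    rw [abs_div, abs_two] at this
    nlinarith
  obtain ⟨u, v, hu, hv, huv⟩ : ∃ u v : ℝ, |u| ≤ 2 * ρ ∧ |v| ≤ 2 * ρ ∧ u * v = c := by
    have hs : Real.sqrt |c| ≤ 2 * ρ := Real.sqrt_le_iff.2 ⟨by positivity, hcb⟩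
    have hs' := Real.mul_self_sqrt (abs_nonneg c)
    rcases le_total 0 c with h | h
    · refine ⟨Real.sqrt |c|, Real.sqrt |c|, ?_, ?_, ?_⟩
      · rwa [abs_of_nonneg (Real.sqrt_nonneg _)]
      · rwa [abs_of_nonneg (Real.sqrt_nonneg _)]
      · rw [hs', abs_of_nonneg h]
    · refine ⟨Real.sqrt |c|, -Real.sqrt |c|, ?_, ?_, ?_⟩
      · rwa [abs_of_nonneg (Real.sqrt_nonneg _)]
      · rwa [abs_neg, abs_of_nonneg (Real.sqrt_nonneg _)]
      · rw [mul_neg, hs', abs_of_nonpos h, neg_neg]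
  refine ⟨[(0, h 0), (1, h 1), (0, u), (1, v), (0, -u), (1, -v)], rfl, ?_, ?_⟩
  · simp only [List.mem_cons, List.not_mem_nil, or_false]
    rintro p (rfl | rfl | rfl | rfl | rfl | rfl) <;> simp only [abs_neg] <;> linarith
  · intro x
    apply hext <;> simp [hseg]
    rw [show h 2 = u * v + h 0 * h 1 / 2 by rw [huv, hc]; ring]
    ring

theorem dH_eq (x : Fin 3 → ℝ) : dH x = sInf (ccLengths x 0) := rfl

theorem dH_nonneg (x : Fin 3 → ℝ) : 0 ≤ dH x :=
  Real.sInf_nonneg fun _ h => nonneg_of_mem_ccLengths h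

theorem bddBelow_ccLengths (x y : Fin 3 → ℝ) : BddBelow (ccLengths x y) :=
  ⟨0, fun _ h => nonneg_of_mem_ccLengths h⟩

theorem ccLengths_nonempty (x : Fin 3 → ℝ) : (ccLengths x 0).Nonempty := by
  have hx : x ∈ hbox (|x 0| + |x 1| + |x 2| + 1) := by
    have h0 := abs_nonneg (x 0)
    have h1 := abs_nonneg (x 1)
    have h2 := abs_nonneg (x 2)
    exact ⟨by linarith, by linarith, by nlinarith⟩
  obtain ⟨l, -, -, hl⟩ := exists_hwalk_eq_hmul (by positivity) hx
  rw [← hmul_zero_left x, ← hl]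
  have : ∀ (l : List (Fin 2 × ℝ)) (y : Fin 3 → ℝ), (ccLengths y 0).Nonempty →
      (ccLengths (hwalk y l) 0).Nonempty := by
    intro l
    induction l with
    | nil => exact fun y hy => hy
    | cons p l ih =>
      intro y hy
      obtain ⟨L, hL⟩ := hy
      exact ih _ ⟨_, add_abs_mem_ccLengths hL p.1 p.2⟩
  exact this l 0 ⟨0, zero_mem_ccLengths⟩

theorem dH_zero : dH 0 = 0 :=
  le_antisymm (csInf_le (bddBelow_ccLengths 0 0) zero_mem_ccLengths) (dH_nonneg 0)

theorem dH_hmul_hseg_le (x : Fin 3 → ℝ) (k : Fin 2) (t : ℝ) :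
    dH (hmul x (hseg k t)) ≤ dH x + |t| := by
  refine le_of_forall_pos_lt_add fun ε hε => ?_
  obtain ⟨L, hL, hLt⟩ := exists_lt_of_csInf_lt (ccLengths_nonempty x)
    (lt_add_of_pos_right (sInf (ccLengths x 0)) hε)
  have := csInf_le (bddBelow_ccLengths _ _) (add_abs_mem_ccLengths hL k t)
  rw [dH_eq, dH_eq]
  linarith

theorem abs_dH_hmul_hseg_sub_le (x : Fin 3 → ℝ) (k : Fin 2) (t : ℝ) :
    |dH (hmul x (hseg k t)) - dH x| ≤ |t| := by
  have h1 := dH_hmul_hseg_le x k t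
  have h2 := dH_hmul_hseg_le (hmul x (hseg k t)) k (-t)
  rw [hmul_hseg_neg, abs_neg] at h2
  exact abs_le.2 ⟨by linarith, by linarith⟩

theorem abs_dH_hwalk_sub_le {τ : ℝ} (l : List (Fin 2 × ℝ)) (hl : ∀ p ∈ l, |p.2| ≤ τ)
    (x : Fin 3 → ℝ) : |dH (hwalk x l) - dH x| ≤ l.length * τ := by
  induction l generalizing x with
  | nil => simp
  | cons p l ih =>
    have h1 := ih (fun q hq => hl q (List.mem_cons_of_mem _ hq)) (hmul x (hseg p.1 p.2))
    have h2 := (abs_dH_hmul_hseg_sub_le x p.1 p.2).trans (hl p List.mem_cons_self)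
    rw [hwalk_cons, List.length_cons]
    push_cast
    rw [abs_le] at *
    constructor <;> nlinarith [h1.1, h1.2, h2.1, h2.2]

theorem abs_dH_hmul_sub_le {g : Fin 3 → ℝ} {ρ : ℝ} (hρ : 0 ≤ ρ) (hg : g ∈ hbox ρ)
    (x : Fin 3 → ℝ) : |dH (hmul x g) - dH x| ≤ 12 * ρ := by
  obtain ⟨l, hlen, hl, hw⟩ := exists_hwalk_eq_hmul hρ hg
  have := abs_dH_hwalk_sub_le l hl x
  rw [hlen, hw] at this
  push_cast at this
  linarith

theorem exists_dH_hmul_le {x : Fin 3 → ℝ} {ℓ : ℝ} (h0 : 0 < ℓ) (h : ℓ ≤ dH x) :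
    ∃ g ∈ hbox ℓ, dH (hmul x g) ≤ dH x - ℓ / 2 := by
  by_cases hattained : ∃ L ∈ ccLengths x 0, ℓ < L ∧ L < dH x + ℓ / 2
  · obtain ⟨L, hL, h1, h2⟩ := hattained
    obtain ⟨g, hg, hg'⟩ := exists_shorter hL h0.le h1
    have := csInf_le (bddBelow_ccLengths _ _) hg'
    rw [← dH_eq] at this
    exact ⟨g, hg, by linarith⟩
  · push Not at hattained
    obtain ⟨L, hL, hLt⟩ := exists_lt_of_csInf_lt (ccLengths_nonempty x)
      (lt_add_of_pos_right (sInf (ccLengths x 0)) (half_pos h0))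
    have h1 : dH x ≤ L := csInf_le (bddBelow_ccLengths _ _) hL
    have h2 : ¬ ℓ < L := fun h3 => absurd (hattained L hL h3) (not_le.2 hLt)
    have h3 : L = ℓ := le_antisymm (not_lt.1 h2) (h.trans h1)
    refine ⟨hdiv x 0, h3 ▸ hdiv_mem_hbox_of_mem_ccLengths hL, ?_⟩
    rw [hmul_hdiv, dH_zero]
    linarith

theorem mem_hbox_dH (x : Fin 3 → ℝ) : x ∈ hbox (dH x) := by
  have key : ∀ L ∈ ccLengths x 0, x ∈ hbox L := by
    intro L hL
    have := hdiv_mem_hbox_of_mem_ccLengths hL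
    simpa [hbox] using this
  have hne := ccLengths_nonempty x
  refine ⟨le_csInf hne fun L hL => (key L hL).1, le_csInf hne fun L hL => (key L hL).2.1, ?_⟩
  have h2 : Real.sqrt |x 2| ≤ dH x := le_csInf hne fun L hL =>
    Real.sqrt_le_iff.2 ⟨nonneg_of_mem_ccLengths hL, (key L hL).2.2⟩
  exact (Real.sqrt_le_left (dH_nonneg x)).1 h2

theorem continuous_hmul : Continuous fun q : (Fin 3 → ℝ) × (Fin 3 → ℝ) => hmul q.1 q.2 := by
  rw [continuous_pi_iff]
  intro i
  fin_cases i <;> simp [hmul] <;> fun_prop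

theorem continuous_dH : Continuous dH := by
  rw [continuous_iff_continuousAt]
  intro x
  rw [ContinuousAt, Metric.tendsto_nhds]
  intro ε hε
  have hρ : 0 < ε / 24 := by positivity
  have hc : ∀ i : Fin 3, Tendsto (fun y => |hdiv x y i|) (nhds x) (nhds 0) := by
    intro i
    have : Continuous fun y => |hdiv x y i| := by
      fin_cases i <;> simp [hdiv] <;> fun_prop
    convert this.tendsto x using 2
    fin_cases i <;> simp [mul_comm]
  filter_upwards [(hc 0).eventually_lt_const hρ, (hc 1).eventually_lt_const hρ,
    (hc 2).eventually_lt_const (pow_pos hρ 2)] with y h0 h1 h2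
  have := abs_dH_hmul_sub_le hρ.le (g := hdiv x y) ⟨h0.le, h1.le, h2.le⟩ x
  rw [hmul_hdiv] at this
  rw [Real.dist_eq]
  linarith

theorem volume_hbox (r : ℝ) (hr : 0 ≤ r) : volume (hbox r) = ENNReal.ofReal (8 * r ^ 4) := by
  have : hbox r = Set.Icc ![-r, -r, -r ^ 2] ![r, r, r ^ 2] := by
    ext g
    simp only [hbox, Set.mem_ofPred_eq, abs_le, Set.mem_Icc, Pi.le_def, Fin.forall_fin_succ]
    simp
    tauto
  rw [this, Real.volume_Icc_pi]
  simp only [Fin.prod_univ_three]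
  rw [← ENNReal.ofReal_mul (by simp; linarith), ← ENNReal.ofReal_mul (by
    simp only [Matrix.cons_val_zero, Matrix.cons_val_one]; nlinarith)]
  congr 1
  simp
  ring

theorem measurableSet_hbox (r : ℝ) : MeasurableSet (hbox r) := by
  have : hbox r = {g : Fin 3 → ℝ | |g 0| ≤ r} ∩ ({g | |g 1| ≤ r} ∩ {g | |g 2| ≤ r ^ 2}) := rfl
  rw [this]
  refine MeasurableSet.inter ?_ (MeasurableSet.inter ?_ ?_) <;>
    exact measurableSet_le (by fun_prop) measurable_const

theorem hbox_mono {r s : ℝ} (hr : 0 ≤ r) (h : r ≤ s) : hbox r ⊆ hbox s := fun _ hg =>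
  ⟨hg.1.trans h, hg.2.1.trans h, hg.2.2.trans (pow_le_pow_left₀ hr h 2)⟩

/-- A shear composed with a translation preserves the volume of `ℝ³`. -/
theorem measurePreserving_shear (u v : ℝ) (w : Fin 3 → ℝ) :
    MeasurePreserving
      (fun x : Fin 3 → ℝ => (![x 0 + w 0, x 1 + w 1, x 2 + w 2 + (u * x 0 + v * x 1)] : Fin 3 → ℝ))
      volume volume := by
  let M : Matrix (Fin 3) (Fin 3) ℝ := !![1, 0, 0; 0, 1, 0; u, v, 1]
  have hdet : M.det = 1 := by simp [M, Matrix.det_fin_three]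
  have h1 : MeasurePreserving (Matrix.toLin' M) volume volume := by
    refine ⟨(LinearMap.continuous_of_finiteDimensional _).measurable, ?_⟩
    rw [Real.map_matrix_volume_pi_eq_smul_volume_pi (by rw [hdet]; exact one_ne_zero), hdet]
    simp
  convert (measurePreserving_add_right volume w).comp h1 using 1
  funext x
  apply hext <;> simp [M, Matrix.toLin'_apply, dotProduct, Fin.sum_univ_three]
  ring

theorem measurePreserving_hmul_right (h : Fin 3 → ℝ) :
    MeasurePreserving (fun x => hmul x h) volume volume := by
  convert measurePreserving_shear (h 1 / 2) (-(h 0 / 2)) h using 1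
  funext x
  exact hext rfl rfl (by simp; ring)

theorem measurePreserving_hmul_left (g : Fin 3 → ℝ) :
    MeasurePreserving (fun x => hmul g x) volume volume := by
  convert measurePreserving_shear (-(g 1 / 2)) (g 0 / 2) g using 1
  funext x
  exact hext (by simp; ring) (by simp; ring) (by simp; ring)

theorem xop_eq_fderiv {m : ℕ} (a : (Fin m → ℝ) → Fin m → ℝ) (f : (Fin m → ℝ) → ℝ)
    (x : Fin m → ℝ) : Xop a f x = fderiv ℝ f x (a x) := by
  conv_rhs => rw [← Finset.univ_sum_single (a x), map_sum]
  refine Finset.sum_congr rfl fun j _ => ?_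
  rw [← smul_eq_mul, ← map_smul, ← Pi.single_smul, smul_eq_mul, mul_one]

theorem continuous_heisA (k : Fin 2) : Continuous (heisA k) := by
  rw [continuous_pi_iff]
  intro i
  fin_cases k <;> fin_cases i <;> simp [heisA] <;> fun_prop

theorem continuous_xop {f : (Fin 3 → ℝ) → ℝ} (hf : ContDiff ℝ 1 f) (k : Fin 2) :
    Continuous (Xop (heisA k) f) := by
  have : Xop (heisA k) f = fun x => fderiv ℝ f x (heisA k x) :=
    funext fun x => xop_eq_fderiv _ _ _
  rw [this]
  exact (hf.continuous_fderiv one_ne_zero).clm_apply (continuous_heisA k)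

theorem continuous_gradSq {f : (Fin 3 → ℝ) → ℝ} (hf : ContDiff ℝ 1 f) :
    Continuous (gradSq heisA f) :=
  continuous_finsetSum _ fun k _ => (continuous_xop hf k).pow 2

theorem gradSq_nonneg {m n : ℕ} (a : Fin n → (Fin m → ℝ) → Fin m → ℝ) (f : (Fin m → ℝ) → ℝ)
    (x : Fin m → ℝ) : 0 ≤ gradSq a f x :=
  Finset.sum_nonneg fun _ _ => sq_nonneg _

theorem xop_sq_le_gradSq (f : (Fin 3 → ℝ) → ℝ) (k : Fin 2) (x : Fin 3 → ℝ) :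
    Xop (heisA k) f x ^ 2 ≤ gradSq heisA f x :=
  Finset.single_le_sum (f := fun k => Xop (heisA k) f x ^ 2) (fun _ _ => sq_nonneg _)
    (Finset.mem_univ k)

theorem continuous_hseg (k : Fin 2) : Continuous (hseg k) := by
  rw [continuous_pi_iff]
  intro i
  fin_cases k <;> fin_cases i <;> simp [hseg] <;> fun_prop

theorem sq_intervalIntegral_le {u : ℝ → ℝ} (hu : Continuous u) :
    (∫ s in (0 : ℝ)..1, u s) ^ 2 ≤ ∫ s in (0 : ℝ)..1, u s ^ 2 := by
  set A := ∫ s in (0 : ℝ)..1, u s with hA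
  have h0 : 0 ≤ ∫ s in (0 : ℝ)..1, (u s - A) ^ 2 :=
    intervalIntegral.integral_nonneg zero_le_one fun _ _ => sq_nonneg _
  have h1 : ∫ s in (0 : ℝ)..1, (u s - A) ^ 2 = (∫ s in (0 : ℝ)..1, u s ^ 2) - A ^ 2 := by
    have : ∀ s, (u s - A) ^ 2 = (u s ^ 2 - 2 * A * u s) + A ^ 2 := fun s => by ring
    simp_rw [this]
    rw [intervalIntegral.integral_add (Continuous.intervalIntegrable (by fun_prop) _ _)
      (by simp), intervalIntegral.integral_sub (Continuous.intervalIntegrable (by fun_prop) _ _)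
      (Continuous.intervalIntegrable (by fun_prop) _ _), intervalIntegral.integral_const_mul, ← hA]
    simp
    ring
  linarith

theorem sq_sub_le_integral_gradSq {f : (Fin 3 → ℝ) → ℝ} (hf : ContDiff ℝ 1 f) (k : Fin 2)
    (t : ℝ) (x : Fin 3 → ℝ) :
    (f (hmul x (hseg k t)) - f x) ^ 2 ≤
      t ^ 2 * ∫ s in (0 : ℝ)..1, gradSq heisA f (hmul x (hseg k (s * t))) := by
  have hcurve : Continuous fun s : ℝ => hmul x (hseg k (s * t)) :=
    continuous_hmul.comp (continuous_const.prodMk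
      ((continuous_hseg k).comp (continuous_id.mul continuous_const)))
  have hu : Continuous fun s : ℝ => Xop (heisA k) f (hmul x (hseg k (s * t))) :=
    (continuous_xop hf k).comp hcurve
  have hd : ∀ s : ℝ, HasDerivAt (fun s => f (hmul x (hseg k (s * t))))
      (Xop (heisA k) f (hmul x (hseg k (s * t))) * t) s := by
    intro s
    have h1 : HasDerivAt (fun u : ℝ => u * t) t s := by
      simpa using (hasDerivAt_id s).mul_const t
    have h2 := HasDerivAt.scomp s (hasDerivAt_hmul_hseg x k (s * t)) h1
    have h3 := ((hf.differentiable one_ne_zero) (hmul x (hseg k (s * t)))).hasFDerivAt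
    refine (h3.comp_hasDerivAt s h2).congr_deriv ?_
    rw [map_smul, xop_eq_fderiv, smul_eq_mul, mul_comm]
  have hftc := intervalIntegral.integral_eq_sub_of_hasDerivAt (a := 0) (b := 1)
    (fun s _ => hd s) ((hu.mul continuous_const).intervalIntegrable _ _)
  have h0 : hmul x (hseg k (0 * t)) = x := by
    apply hext <;> fin_cases k <;> simp [hseg]
  rw [intervalIntegral.integral_mul_const, h0, one_mul] at hftc
  rw [← hftc, mul_pow, mul_comm]
  refine mul_le_mul_of_nonneg_left ((sq_intervalIntegral_le hu).trans ?_) (sq_nonneg t)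
  exact intervalIntegral.integral_mono_on zero_le_one ((hu.pow 2).intervalIntegrable _ _)
    (((continuous_gradSq hf).comp hcurve).intervalIntegrable _ _) fun s _ => xop_sq_le_gradSq _ _ _

theorem lintegral_sq_sub_hseg_le {f : (Fin 3 → ℝ) → ℝ} (hf : ContDiff ℝ 1 f) (k : Fin 2) (t : ℝ)
    {W W' : (Fin 3 → ℝ) → ENNReal} (hW' : Measurable W')
    (hWW' : ∀ x s, |s| ≤ |t| → W x ≤ W' (hmul x (hseg k s))) :
    ∫⁻ x, ENNReal.ofReal ((f (hmul x (hseg k t)) - f x) ^ 2) * W x ≤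
      ENNReal.ofReal (t ^ 2) * ∫⁻ x, ENNReal.ofReal (gradSq heisA f x) * W' x := by
  set F : (Fin 3 → ℝ) → ENNReal := fun x => ENNReal.ofReal (gradSq heisA f x) * W' x with hF
  have hFm : Measurable F := (continuous_gradSq hf).measurable.ennreal_ofReal.mul hW'
  have hcurve : ∀ x, Continuous fun s : ℝ => hmul x (hseg k (s * t)) := fun x =>
    continuous_hmul.comp (continuous_const.prodMk
      ((continuous_hseg k).comp (continuous_id.mul continuous_const)))
  have hpt : ∀ x, ENNReal.ofReal ((f (hmul x (hseg k t)) - f x) ^ 2) * W x ≤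
      ENNReal.ofReal (t ^ 2) * ∫⁻ s in Set.Ioc (0 : ℝ) 1, F (hmul x (hseg k (s * t))) := by
    intro x
    have hg : Continuous fun s : ℝ => gradSq heisA f (hmul x (hseg k (s * t))) :=
      (continuous_gradSq hf).comp (hcurve x)
    have h1 := ENNReal.ofReal_le_ofReal (sq_sub_le_integral_gradSq hf k t x)
    rw [ENNReal.ofReal_mul (sq_nonneg t), intervalIntegral.integral_of_le zero_le_one,
      ofReal_integral_eq_lintegral_ofReal (hg.integrableOn_Ioc)
        (Eventually.of_forall fun s => gradSq_nonneg _ _ _)] at h1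
    refine (mul_le_mul_left h1 (W x)).trans ?_
    rw [mul_assoc, ← lintegral_mul_const _ hg.measurable.ennreal_ofReal]
    refine mul_le_mul_right (setLIntegral_mono' measurableSet_Ioc fun s hs => ?_) _
    refine mul_le_mul_right (hWW' x (s * t) ?_) _
    rw [abs_mul, abs_of_pos hs.1]
    exact mul_le_of_le_one_left (abs_nonneg t) hs.2
  refine (lintegral_mono hpt).trans ?_
  have hmeas : Measurable fun q : (Fin 3 → ℝ) × ℝ => F (hmul q.1 (hseg k (q.2 * t))) := by
    refine hFm.comp (Continuous.measurable ?_)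
    exact continuous_hmul.comp (continuous_fst.prodMk
      ((continuous_hseg k).comp (continuous_snd.mul continuous_const)))
  rw [lintegral_const_mul' _ _ ENNReal.ofReal_ne_top, lintegral_lintegral_swap hmeas.aemeasurable]
  refine mul_le_mul_right (le_of_eq ?_) _
  calc ∫⁻ s in Set.Ioc (0 : ℝ) 1, ∫⁻ x, F (hmul x (hseg k (s * t)))
      = ∫⁻ s in Set.Ioc (0 : ℝ) 1, ∫⁻ x, F x := by
        congr 1
        funext s
        exact (measurePreserving_hmul_right _).lintegral_comp hFm
    _ = ∫⁻ x, F x := by simp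

theorem lintegral_sq_sub_hwalk_le {f : (Fin 3 → ℝ) → ℝ} (hf : ContDiff ℝ 1 f) {τ : ℝ}
    (hτ : 0 ≤ τ) {W' : (Fin 3 → ℝ) → ENNReal} (hW' : Measurable W')
    (l : List (Fin 2 × ℝ)) (hl : ∀ p ∈ l, |p.2| ≤ τ)
    {W : (Fin 3 → ℝ) → ENNReal} (hW : Measurable W)
    (hWW' : ∀ x z, |dH z - dH x| ≤ l.length * τ → W x ≤ W' z) :
    ∫⁻ x, ENNReal.ofReal ((f (hwalk x l) - f x) ^ 2) * W x ≤
      ENNReal.ofReal (4 ^ l.length * τ ^ 2) *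
        ∫⁻ x, ENNReal.ofReal (gradSq heisA f x) * W' x := by
  have hwalk_cont : ∀ l : List (Fin 2 × ℝ), Continuous fun x => hwalk x l := by
    intro l
    induction l with
    | nil => exact continuous_id
    | cons p l ih => exact ih.comp (continuous_hmul.comp (continuous_id.prodMk continuous_const))
  induction l generalizing W with
  | nil => simp
  | cons p l ih =>
    set D := ∫⁻ x, ENNReal.ofReal (gradSq heisA f x) * W' x
    set s := hseg p.1 p.2
    have hp := hl p List.mem_cons_self
    have hlen : ((p :: l).length : ℝ) = l.length + 1 := by simp
    rw [hlen] at hWW'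
    have hlτ : 0 ≤ (l.length : ℝ) * τ := by positivity
    have hW₁ : Measurable fun y => W (hmul y (hseg p.1 (-p.2))) :=
      hW.comp (measurePreserving_hmul_right _).measurable
    have h1 := ih (fun q hq => hl q (List.mem_cons_of_mem _ hq)) hW₁ (by
      intro y z hyz
      refine hWW' _ _ ?_
      have := (abs_dH_hmul_hseg_sub_le y p.1 (-p.2)).trans ((abs_neg p.2).trans_le hp)
      rw [abs_le] at hyz this ⊢
      constructor <;> linarith)
    have h2 := lintegral_sq_sub_hseg_le hf p.1 p.2 (W := W) hW' (by
      intro x u hu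
      refine hWW' _ _ ?_
      have := (abs_dH_hmul_hseg_sub_le x p.1 u).trans (hu.trans hp)
      linarith)
    have hm1 : Measurable fun y => ENNReal.ofReal ((f (hwalk y l) - f y) ^ 2) *
        W (hmul y (hseg p.1 (-p.2))) := by
      refine Measurable.mul ?_ hW₁
      exact (((hf.continuous.comp (hwalk_cont l)).sub hf.continuous).pow 2).measurable.ennreal_ofReal
    rw [← (measurePreserving_hmul_right s).lintegral_comp hm1] at h1
    simp only [s, hmul_hseg_neg] at h1
    have hpt : ∀ x, ENNReal.ofReal ((f (hwalk x (p :: l)) - f x) ^ 2) * W x ≤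
        2 * (ENNReal.ofReal ((f (hwalk (hmul x s) l) - f (hmul x s)) ^ 2) * W x) +
        2 * (ENNReal.ofReal ((f (hmul x s) - f x) ^ 2) * W x) := by
      intro x
      rw [← mul_add, ← add_mul, ← mul_assoc, ← ENNReal.ofReal_add (sq_nonneg _) (sq_nonneg _),
        show (2 : ENNReal) = ENNReal.ofReal 2 by simp, ← ENNReal.ofReal_mul (by norm_num)]
      refine mul_le_mul_left (ENNReal.ofReal_le_ofReal ?_) _
      rw [hwalk_cons]
      nlinarith [sq_nonneg ((f (hwalk (hmul x s) l) - f (hmul x s)) - (f (hmul x s) - f x))]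
    have hm2 : Measurable fun x => 2 * (ENNReal.ofReal ((f (hmul x s) - f x) ^ 2) * W x) := by
      refine ((Measurable.ennreal_ofReal ?_).mul hW).const_mul 2
      exact (((hf.continuous.measurable.comp (measurePreserving_hmul_right s).measurable).sub
        hf.continuous.measurable).pow_const 2)
    refine (lintegral_mono hpt).trans ?_
    rw [lintegral_add_right _ hm2, lintegral_const_mul' _ _ (by simp),
      lintegral_const_mul' _ _ (by simp)]
    have hsq : p.2 ^ 2 ≤ τ ^ 2 := by rw [← sq_abs]; exact pow_le_pow_left₀ (abs_nonneg _) hp 2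
    calc _ ≤ 2 * (ENNReal.ofReal (4 ^ l.length * τ ^ 2) * D) + 2 * (ENNReal.ofReal (τ ^ 2) * D) := by
            refine add_le_add (mul_le_mul_right h1 2) (mul_le_mul_right (h2.trans ?_) 2)
            exact mul_le_mul_left (ENNReal.ofReal_le_ofReal hsq) _
      _ = ENNReal.ofReal (2 * (4 ^ l.length * τ ^ 2) + 2 * τ ^ 2) * D := by
            rw [ENNReal.ofReal_add (by positivity) (by positivity),
              ENNReal.ofReal_mul zero_le_two, ENNReal.ofReal_mul zero_le_two]
            simp
            ring
      _ ≤ _ := by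
            refine mul_le_mul_left (ENNReal.ofReal_le_ofReal ?_) _
            rw [List.length_cons, pow_succ (4 : ℝ)]
            have : (1 : ℝ) ≤ 4 ^ l.length := one_le_pow₀ (by norm_num)
            nlinarith [mul_nonneg (sub_nonneg.2 this) (sq_nonneg τ)]

/-- Small right translations cost at most the horizontal energy. -/
theorem lintegral_sq_sub_hmul_le {f : (Fin 3 → ℝ) → ℝ} (hf : ContDiff ℝ 1 f) {ρ : ℝ}
    (hρ : 0 ≤ ρ) {h : Fin 3 → ℝ} (hh : h ∈ hbox ρ) {W W' : (Fin 3 → ℝ) → ENNReal}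
    (hW : Measurable W) (hW' : Measurable W')
    (hWW' : ∀ x z, |dH z - dH x| ≤ 12 * ρ → W x ≤ W' z) :
    ∫⁻ x, ENNReal.ofReal ((f (hmul x h) - f x) ^ 2) * W x ≤
      ENNReal.ofReal (16384 * ρ ^ 2) * ∫⁻ x, ENNReal.ofReal (gradSq heisA f x) * W' x := by
  obtain ⟨l, hlen, hl, hw⟩ := exists_hwalk_eq_hmul hρ hh
  have := lintegral_sq_sub_hwalk_le hf (τ := 2 * ρ) (by positivity) hW' l hl hW (by
    intro x z hxz
    refine hWW' x z (hxz.trans (le_of_eq ?_))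
    rw [hlen]; push_cast; ring)
  simp only [hw, hlen] at this
  convert this using 3
  ring

theorem mul_rpow_le_rpow_sub_rpow {d z u p : ℝ} (hz : 0 ≤ z) (hu : 0 ≤ u) (hzd : z ≤ d - u)
    (hp : 1 ≤ p) : u * d ^ (p - 1) ≤ d ^ p - z ^ p := by
  rcases hz.eq_or_lt with rfl | hz0
  · rcases (hu.trans (by linarith : u ≤ d)).eq_or_lt with rfl | hd
    · have : u = 0 := by linarith
      simp [this]
    rw [Real.zero_rpow (by linarith), sub_zero]
    calc u * d ^ (p - 1) ≤ d * d ^ (p - 1) :=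
          mul_le_mul_of_nonneg_right (by linarith) (Real.rpow_nonneg hd.le _)
      _ = d ^ p := by rw [← Real.rpow_one_add' hd.le (by linarith)]; ring_nf
  · have hd : 0 < d := by linarith
    have h1 : z ^ (p - 1) ≤ d ^ (p - 1) :=
      Real.rpow_le_rpow hz0.le (by linarith) (by linarith)
    have e1 : d ^ p = d * d ^ (p - 1) := by
      rw [← Real.rpow_one_add' hd.le (by linarith)]; ring_nf
    have e2 : z ^ p = z * z ^ (p - 1) := by
      rw [← Real.rpow_one_add' hz0.le (by linarith)]; ring_nf
    have h2 : 0 ≤ d ^ (p - 1) := Real.rpow_nonneg hd.le _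
    rw [e1, e2]
    nlinarith [mul_le_mul_of_nonneg_left h1 hz0.le]

theorem abs_rpow_sub_rpow_le {a b B p : ℝ} (ha : 0 ≤ a) (haB : a ≤ B) (hb : 0 ≤ b) (hbB : b ≤ B)
    (hp : 1 ≤ p) : |a ^ p - b ^ p| ≤ p * B ^ (p - 1) * |a - b| := by
  have := (convex_Icc (0 : ℝ) B).norm_image_sub_le_of_norm_hasDerivWithin_le
    (f := fun s : ℝ => s ^ p) (f' := fun s => p * s ^ (p - 1)) (C := p * B ^ (p - 1))
    (fun s _ => (Real.hasDerivAt_rpow_const (Or.inr hp)).hasDerivWithinAt)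
    (fun s hs => by
      rw [Real.norm_eq_abs, abs_of_nonneg (mul_nonneg (by linarith) (Real.rpow_nonneg hs.1 _))]
      exact mul_le_mul_of_nonneg_left (Real.rpow_le_rpow hs.1 hs.2 (by linarith)) (by linarith))
    (Set.mem_Icc.2 ⟨hb, hbB⟩) (Set.mem_Icc.2 ⟨ha, haB⟩)
  simpa using this

/-- The unnormalised Gibbs weight. -/
def hweight (β p : ℝ) (x : Fin 3 → ℝ) : ENNReal := ENNReal.ofReal (Real.exp (-(β * dH x ^ p)))

theorem continuous_exp_neg_dH {β p : ℝ} (hp : 0 ≤ p) :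
    Continuous fun x => Real.exp (-(β * dH x ^ p)) :=
  Real.continuous_exp.comp ((continuous_dH.rpow_const fun _ => Or.inr hp).const_mul β).neg

theorem measurable_hweight {β p : ℝ} (hp : 0 ≤ p) : Measurable (hweight β p) :=
  (continuous_exp_neg_dH hp).measurable.ennreal_ofReal

theorem hweight_le_mul {β p s : ℝ} {x z : Fin 3 → ℝ} (h : β * dH z ^ p ≤ β * dH x ^ p + s) :
    hweight β p x ≤ ENNReal.ofReal (Real.exp s) * hweight β p z := by
  rw [hweight, hweight, ← ENNReal.ofReal_mul (Real.exp_pos _).le, ← Real.exp_add]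
  exact ENNReal.ofReal_le_ofReal (Real.exp_le_exp.2 (by linarith))

theorem hweight_le_mul_of_abs_sub_le {β p r B δ : ℝ} (hβ : 0 ≤ β) (hp : 1 ≤ p) {x z : Fin 3 → ℝ}
    (hr : 0 < r) (hx : dH x ≤ B * r) (hz : dH z ≤ B * r)
    (hxz : |dH z - dH x| ≤ δ * r ^ (1 - p)) :
    hweight β p x ≤ ENNReal.ofReal (Real.exp (β * (p * B ^ (p - 1) * δ))) * hweight β p z := by
  refine hweight_le_mul ?_
  have h1 := abs_rpow_sub_rpow_le (dH_nonneg z) hz (dH_nonneg x) hx hp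
  have hB : 0 ≤ B := by
    by_contra hB
    have := mul_neg_of_neg_of_pos (not_le.1 hB) hr
    linarith [dH_nonneg x]
  have h2 : p * (B * r) ^ (p - 1) * |dH z - dH x| ≤ p * B ^ (p - 1) * δ := by
    calc p * (B * r) ^ (p - 1) * |dH z - dH x| ≤ p * (B * r) ^ (p - 1) * (δ * r ^ (1 - p)) := by
          refine mul_le_mul_of_nonneg_left hxz (mul_nonneg (by linarith) ?_)
          exact Real.rpow_nonneg (by positivity) _
      _ = p * B ^ (p - 1) * δ * (r ^ (p - 1) * r ^ (1 - p)) := by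
          rw [Real.mul_rpow hB hr.le]; ring
      _ = p * B ^ (p - 1) * δ := by
          rw [← Real.rpow_add hr]; simp
  have h3 := (le_abs_self _).trans (h1.trans h2)
  nlinarith

theorem hmul_mem_hbox_two_mul {ℓ : ℝ} (hℓ : 0 ≤ ℓ) {g k : Fin 3 → ℝ} (hg : g ∈ hbox ℓ)
    (hk : k ∈ hbox (ℓ / 48)) : hmul g k ∈ hbox (2 * ℓ) := by
  obtain ⟨g0, g1, g2⟩ := hg
  obtain ⟨k0, k1, k2⟩ := hk
  refine ⟨?_, ?_, ?_⟩
  · rw [hmul_zero']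
    exact (abs_add_le _ _).trans (by linarith)
  · rw [hmul_one']
    exact (abs_add_le _ _).trans (by linarith)
  · rw [hmul_two']
    have a1 := abs_add_le (g 2 + k 2) ((g 0 * k 1 - g 1 * k 0) / 2)
    have a2 := abs_add_le (g 2) (k 2)
    have a3 := abs_sub (g 0 * k 1) (g 1 * k 0)
    have a4 : |g 0 * k 1| ≤ ℓ * (ℓ / 48) := by
      rw [abs_mul]; exact mul_le_mul g0 k1 (abs_nonneg _) hℓ
    have a5 : |g 1 * k 0| ≤ ℓ * (ℓ / 48) := by
      rw [abs_mul]; exact mul_le_mul g1 k0 (abs_nonneg _) hℓ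
    rw [abs_div, abs_two] at a1
    nlinarith

theorem measurable_hmul : Measurable fun q : (Fin 3 → ℝ) × (Fin 3 → ℝ) => hmul q.1 q.2 :=
  continuous_hmul.measurable

theorem measurable_dH : Measurable dH := continuous_dH.measurable

/-- Averaging over a neighbourhood of a point lying closer to the origin. -/
theorem ofReal_sq_mul_volume_le {f : (Fin 3 → ℝ) → ℝ} (hf : Measurable f) {x : Fin 3 → ℝ} {ℓ : ℝ}
    (hℓ : 0 < ℓ) (hx : ℓ ≤ dH x) :
    ENNReal.ofReal (f x ^ 2) * volume (hbox (ℓ / 48)) ≤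
      ∫⁻ h in hbox (2 * ℓ), ({z | dH z ≤ dH x - ℓ / 4}.indicator
        (fun z => 2 * ENNReal.ofReal (f z ^ 2)) (hmul x h) +
          2 * ENNReal.ofReal ((f (hmul x h) - f x) ^ 2)) := by
  obtain ⟨g, hg, hgx⟩ := exists_dH_hmul_le hℓ hx
  have hxm : Measurable fun h => hmul x h := (measurePreserving_hmul_left x).measurable
  have hmeas : Measurable fun h => {z | dH z ≤ dH x - ℓ / 4}.indicator
        (fun z => 2 * ENNReal.ofReal (f z ^ 2)) (hmul x h) +
          2 * ENNReal.ofReal ((f (hmul x h) - f x) ^ 2) := by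
    refine Measurable.add ?_ ?_
    · refine Measurable.comp (g := {z | dH z ≤ dH x - ℓ / 4}.indicator
        (fun z => 2 * ENNReal.ofReal (f z ^ 2))) ?_ hxm
      exact ((hf.pow_const 2).ennreal_ofReal.const_mul 2).indicator
        (measurableSet_le measurable_dH measurable_const)
    · exact (((hf.comp hxm).sub_const (f x)).pow_const 2).ennreal_ofReal.const_mul 2
  rw [← setLIntegral_const, ← lintegral_indicator (measurableSet_hbox _),
    ← lintegral_indicator (measurableSet_hbox _),
    ← (measurePreserving_hmul_left g).lintegral_comp (hmeas.indicator (measurableSet_hbox _))]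
  refine lintegral_mono fun k => ?_
  by_cases hk : k ∈ hbox (ℓ / 48)
  swap
  · rw [Set.indicator_of_notMem hk]
    exact zero_le
  rw [Set.indicator_of_mem hk]
  have hd := abs_dH_hmul_sub_le (by positivity) hk (hmul x g)
  rw [abs_le] at hd
  have hmem : hmul x (hmul g k) ∈ {z | dH z ≤ dH x - ℓ / 4} := by
    rw [Set.mem_ofPred_eq, ← hmul_assoc]
    linarith [hd.2]
  rw [Set.indicator_of_mem (hmul_mem_hbox_two_mul hℓ.le hg hk), Set.indicator_of_mem hmem,
    ← mul_add, ← ENNReal.ofReal_add (sq_nonneg _) (sq_nonneg _),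
    show (2 : ENNReal) = ENNReal.ofReal 2 by simp, ← ENNReal.ofReal_mul zero_le_two]
  refine ENNReal.ofReal_le_ofReal ?_
  nlinarith [sq_nonneg (2 * f (hmul x (hmul g k)) - f x)]

theorem volume_hbox_two_mul {ℓ : ℝ} (hℓ : 0 ≤ ℓ) :
    volume (hbox (2 * ℓ)) = 96 ^ 4 * volume (hbox (ℓ / 48)) := by
  rw [volume_hbox _ (by positivity), volume_hbox _ (by positivity),
    show (96 : ENNReal) = ENNReal.ofReal 96 by simp, ← ENNReal.ofReal_pow (by norm_num),
    ← ENNReal.ofReal_mul (by norm_num)]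
  congr 1
  ring

theorem setLIntegral_shell_le {f : (Fin 3 → ℝ) → ℝ} (hf : ContDiff ℝ 1 f) {r ℓ : ℝ}
    (hℓ : 0 < ℓ) (hℓ1 : 24 * ℓ ≤ 1) (hr : 1 ≤ r) {w : (Fin 3 → ℝ) → ENNReal} (hw : Measurable w)
    {e K : ENNReal}
    (hdrop : ∀ x z, r ≤ dH x → dH z ≤ dH x - ℓ / 4 → w x ≤ e * w z)
    (hcomp : ∀ x z, r ≤ dH x → dH x < r + 1 → |dH z - dH x| ≤ 24 * ℓ → w x ≤ K * w z) :
    ∫⁻ x in {x | r ≤ dH x ∧ dH x < r + 1}, ENNReal.ofReal (f x ^ 2) * w x ≤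
      96 ^ 4 * (2 * e * ∫⁻ x in {x | r - 1 ≤ dH x ∧ dH x < r + 2}, ENNReal.ofReal (f x ^ 2) * w x) +
      96 ^ 4 * (2 * (ENNReal.ofReal (65536 * ℓ ^ 2) * (K *
        ∫⁻ x in {x | r - 1 ≤ dH x ∧ dH x < r + 2}, ENNReal.ofReal (gradSq heisA f x) * w x))) := by
  set S := {x | r ≤ dH x ∧ dH x < r + 1} with hS
  set T := {x | r - 1 ≤ dH x ∧ dH x < r + 2} with hT
  have hSm : MeasurableSet S := (measurableSet_le measurable_const measurable_dH).inter
    (measurableSet_lt measurable_dH measurable_const)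
  have hTm : MeasurableSet T := (measurableSet_le measurable_const measurable_dH).inter
    (measurableSet_lt measurable_dH measurable_const)
  have hfm := hf.continuous.measurable
  have hST : ∀ x z, x ∈ S → |dH z - dH x| ≤ 24 * ℓ → z ∈ T := by
    intro x z hx hxz
    rw [abs_le] at hxz
    exact ⟨by linarith [hx.1], by linarith [hx.2]⟩
  set F : (Fin 3 → ℝ) → ENNReal := T.indicator fun z => ENNReal.ofReal (f z ^ 2) * w z with hF
  have hFm : Measurable F := ((hfm.pow_const 2).ennreal_ofReal.mul hw).indicator hTm
  set V := volume (hbox (ℓ / 48)) with hV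
  have hV0 : V ≠ 0 := by
    rw [hV, volume_hbox _ (by positivity)]
    simp only [ne_eq, ENNReal.ofReal_eq_zero, not_le]
    positivity
  have hVt : V ≠ ⊤ := by
    rw [hV, volume_hbox _ (by positivity)]
    exact ENNReal.ofReal_ne_top
  have hkey : V * ∫⁻ x in S, ENNReal.ofReal (f x ^ 2) * w x ≤
      (96 ^ 4 * V) * (2 * e * ∫⁻ x, F x) + (96 ^ 4 * V) * (2 * (ENNReal.ofReal (65536 * ℓ ^ 2) * (K *
        ∫⁻ x in T, ENNReal.ofReal (gradSq heisA f x) * w x))) := by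
    have hpt : ∀ x ∈ S, ENNReal.ofReal (f x ^ 2) * w x * V ≤
        ∫⁻ h in hbox (2 * ℓ), (2 * e * F (hmul x h) +
          2 * (ENNReal.ofReal ((f (hmul x h) - f x) ^ 2) * S.indicator w x)) := by
      intro x hx
      calc ENNReal.ofReal (f x ^ 2) * w x * V = ENNReal.ofReal (f x ^ 2) * V * w x := by ring
        _ ≤ _ := mul_le_mul_left (ofReal_sq_mul_volume_le hfm hℓ (by linarith [hx.1])) _
        _ ≤ _ := lintegral_mul_const_le _ _
        _ ≤ _ := by
          refine setLIntegral_mono' (measurableSet_hbox _) fun h hh => ?_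
          rw [add_mul, Set.indicator_of_mem hx, mul_assoc 2 (ENNReal.ofReal _) (w x)]
          refine add_le_add ?_ le_rfl
          by_cases hz : hmul x h ∈ {z | dH z ≤ dH x - ℓ / 4}
          · have hzT : hmul x h ∈ T := hST x _ hx <| by
              refine (abs_dH_hmul_sub_le (by positivity) hh x).trans (by linarith)
            rw [Set.indicator_of_mem hz, hF, Set.indicator_of_mem hzT]
            calc 2 * ENNReal.ofReal (f (hmul x h) ^ 2) * w x
                ≤ 2 * ENNReal.ofReal (f (hmul x h) ^ 2) * (e * w (hmul x h)) :=
                  mul_le_mul_right (hdrop _ _ hx.1 hz) _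
              _ = _ := by ring
          · rw [Set.indicator_of_notMem hz]
            simp
    have hsw : Measurable fun x => ENNReal.ofReal (f x ^ 2) * w x :=
      (hfm.pow_const 2).ennreal_ofReal.mul hw
    have hm1 : Measurable fun q : (Fin 3 → ℝ) × (Fin 3 → ℝ) => 2 * e * F (hmul q.1 q.2) :=
      (hFm.comp measurable_hmul).const_mul _
    have hm2 : Measurable fun q : (Fin 3 → ℝ) × (Fin 3 → ℝ) =>
        2 * (ENNReal.ofReal ((f (hmul q.1 q.2) - f q.1) ^ 2) * S.indicator w q.1) := by
      refine Measurable.const_mul (Measurable.mul ?_ ((hw.indicator hSm).comp measurable_fst)) 2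
      exact (((hfm.comp measurable_hmul).sub (hfm.comp measurable_fst)).pow_const 2).ennreal_ofReal
    rw [mul_comm, ← lintegral_mul_const _ hsw]
    refine (setLIntegral_mono' hSm hpt).trans ((setLIntegral_le_lintegral _ _).trans ?_)
    rw [lintegral_lintegral_swap (hm1.add hm2).aemeasurable]
    have hin : ∀ h ∈ hbox (2 * ℓ), ∫⁻ x, (2 * e * F (hmul x h) +
          2 * (ENNReal.ofReal ((f (hmul x h) - f x) ^ 2) * S.indicator w x)) ≤
        2 * e * (∫⁻ x, F x) + 2 * (ENNReal.ofReal (65536 * ℓ ^ 2) * (K *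
        ∫⁻ x in T, ENNReal.ofReal (gradSq heisA f x) * w x)) := by
      intro h hh
      have hFh : Measurable fun x => F (hmul x h) :=
        hFm.comp (measurePreserving_hmul_right h).measurable
      rw [lintegral_add_left (hFh.const_mul _), lintegral_const_mul _ hFh,
        (measurePreserving_hmul_right h).lintegral_comp hFm, lintegral_const_mul' _ _ (by simp)]
      refine add_le_add le_rfl (mul_le_mul_right ?_ 2)
      have := lintegral_sq_sub_hmul_le hf (by positivity) hh (hw.indicator hSm)
        ((hw.indicator hTm).const_mul K) (by
          intro x z hxz
          by_cases hx : x ∈ S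
          · have hxz' : |dH z - dH x| ≤ 24 * ℓ := by linarith
            rw [Set.indicator_of_mem hx, Set.indicator_of_mem (hST x z hx hxz')]
            exact hcomp x z hx.1 hx.2 hxz'
          · rw [Set.indicator_of_notMem hx]
            exact zero_le)
      refine this.trans (le_of_eq ?_)
      have hg : Measurable fun x => ENNReal.ofReal (gradSq heisA f x) * w x :=
        (continuous_gradSq hf).measurable.ennreal_ofReal.mul hw
      rw [← lintegral_const_mul _ hg, ← lintegral_indicator hTm]
      congr 1
      · congr 1; ring
      · congr 1
        funext x
        by_cases hx : x ∈ T
        · simp only [Set.indicator_of_mem hx]; ring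
        · simp only [Set.indicator_of_notMem hx]; ring
    refine (setLIntegral_mono' (measurableSet_hbox _) hin).trans ?_
    rw [setLIntegral_const, volume_hbox_two_mul hℓ.le, add_mul, mul_comm, mul_comm _ (96 ^ 4 * V)]
  rw [← ENNReal.mul_le_mul_iff_right hV0 hVt]
  refine hkey.trans (le_of_eq ?_)
  rw [hF, lintegral_indicator hTm]
  ring

theorem tsum_setLIntegral_shell_le (a : ℝ) (F : (Fin 3 → ℝ) → ENNReal) :
    ∑' j : ℕ, ∫⁻ x in {x | a + j ≤ dH x ∧ dH x < a + j + 3}, F x ≤ 3 * ∫⁻ x, F x := by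
  let T : ℕ → Set (Fin 3 → ℝ) := fun i => {x | a + i ≤ dH x ∧ dH x < a + i + 1}
  have hTm : ∀ i, MeasurableSet (T i) := fun i =>
    (measurableSet_le measurable_const measurable_dH).inter
      (measurableSet_lt measurable_dH measurable_const)
  have hdisj : Pairwise (Function.onFun Disjoint T) := by
    intro i j hij
    rw [Function.onFun, Set.disjoint_left]
    rintro x ⟨h1, h2⟩ ⟨h3, h4⟩
    have h5 : (i : ℝ) < j + 1 := by linarith
    have h6 : (j : ℝ) < i + 1 := by linarith
    norm_cast at h5 h6
    omega
  have hone : ∀ k : ℕ, ∑' j : ℕ, ∫⁻ x in T (j + k), F x ≤ ∫⁻ x, F x := by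
    intro k
    rw [← lintegral_iUnion (fun j => hTm (j + k))
      (fun i j hij => hdisj (fun h => hij (Nat.add_right_cancel h)))]
    exact setLIntegral_le_lintegral _ _
  have hsub : ∀ j : ℕ, ∫⁻ x in {x | a + j ≤ dH x ∧ dH x < a + j + 3}, F x ≤
      (∫⁻ x in T (j + 0), F x) + ((∫⁻ x in T (j + 1), F x) + ∫⁻ x in T (j + 2), F x) := by
    intro j
    refine (lintegral_mono_set ?_).trans ((lintegral_union_le _ _ _).trans
      (add_le_add le_rfl (lintegral_union_le _ _ _)))
    rintro x ⟨h1, h2⟩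
    simp only [T, Set.mem_union, Set.mem_ofPred_eq]
    push_cast
    rcases lt_or_ge (dH x) (a + j + 1) with h | h
    · left; constructor <;> linarith
    rcases lt_or_ge (dH x) (a + j + 2) with h' | h'
    · right; left; constructor <;> linarith
    · right; right; constructor <;> linarith
  calc _ ≤ ∑' j : ℕ, ((∫⁻ x in T (j + 0), F x) +
          ((∫⁻ x in T (j + 1), F x) + ∫⁻ x in T (j + 2), F x)) := ENNReal.tsum_le_tsum hsub
    _ ≤ (∫⁻ x, F x) + ((∫⁻ x, F x) + ∫⁻ x, F x) := by
        rw [ENNReal.tsum_add, ENNReal.tsum_add]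
        exact add_le_add (hone 0) (add_le_add (hone 1) (hone 2))
    _ = 3 * ∫⁻ x, F x := by ring

theorem rpow_one_sub_mul_le {p r M : ℝ} (hp : 2 ≤ p) (hr : 1 ≤ r) (hrM : M ≤ r) :
    M * r ^ (1 - p) ≤ 1 := by
  have hr0 : 0 < r := by linarith
  have h1 : r ^ (1 - p) ≤ r ^ (-1 : ℝ) := Real.rpow_le_rpow_of_exponent_le hr (by linarith)
  rw [Real.rpow_neg_one] at h1
  calc M * r ^ (1 - p) ≤ r * r⁻¹ := mul_le_mul hrM h1 (by positivity) hr0.le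
    _ = 1 := mul_inv_cancel₀ hr0.ne'

/-- Mass far from the origin is controlled by a small multiple of the total mass and the energy. -/
theorem exists_setLIntegral_far_le {β p : ℝ} (hβ : 0 < β) (hp : 2 ≤ p) :
    ∃ C R₀ : ℝ, 0 < C ∧ 1 ≤ R₀ ∧ ∀ R, R₀ ≤ R → ∀ f : (Fin 3 → ℝ) → ℝ, ContDiff ℝ 1 f →
      ∫⁻ x in {x | R ≤ dH x}, ENNReal.ofReal (f x ^ 2) * hweight β p x ≤
        (ENNReal.ofReal (1 / 4) * ∫⁻ x, ENNReal.ofReal (f x ^ 2) * hweight β p x) +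
        ENNReal.ofReal (C * R ^ (2 - 2 * p)) *
          ∫⁻ x, ENNReal.ofReal (gradSq heisA f x) * hweight β p x := by
  obtain ⟨M, hM, hMe⟩ : ∃ M : ℝ, 0 < M ∧ Real.exp (-(β * M / 4)) = 1 / (24 * 96 ^ 4) := by
    refine ⟨4 / β * Real.log (24 * 96 ^ 4), mul_pos (by positivity) (Real.log_pos (by norm_num)), ?_⟩
    rw [show -(β * (4 / β * Real.log (24 * 96 ^ 4)) / 4) = -Real.log (24 * 96 ^ 4) by field_simp,
      Real.exp_neg, Real.exp_log (by norm_num), one_div]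
  set Kr := Real.exp (β * (p * 3 ^ (p - 1) * (24 * M))) with hKr
  have hKpos : 0 < Kr := Real.exp_pos _
  refine ⟨96 ^ 4 * 2 * 65536 * 3 * M ^ 2 * Kr, max 1 (24 * M), by positivity, le_max_left _ _, ?_⟩
  intro R hR f hf
  have hR1 : 1 ≤ R := (le_max_left _ _).trans hR
  have hRM : 24 * M ≤ R := (le_max_right _ _).trans hR
  have hR0 : 0 < R := by linarith
  set w := hweight β p
  set A := ∫⁻ x, ENNReal.ofReal (f x ^ 2) * w x
  set G := ∫⁻ x, ENNReal.ofReal (gradSq heisA f x) * w x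
  have hshell : ∀ j : ℕ, ∫⁻ x in {x | R + j ≤ dH x ∧ dH x < R + j + 1},
      ENNReal.ofReal (f x ^ 2) * w x ≤
      96 ^ 4 * 2 * ENNReal.ofReal (1 / (24 * 96 ^ 4)) *
        (∫⁻ x in {x | R - 1 + j ≤ dH x ∧ dH x < R - 1 + j + 3}, ENNReal.ofReal (f x ^ 2) * w x) +
      96 ^ 4 * 2 * ENNReal.ofReal (65536 * (M ^ 2 * R ^ (2 - 2 * p))) * ENNReal.ofReal Kr *
        ∫⁻ x in {x | R - 1 + j ≤ dH x ∧ dH x < R - 1 + j + 3},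
          ENNReal.ofReal (gradSq heisA f x) * w x := by
    intro j
    have hj : (0 : ℝ) ≤ j := Nat.cast_nonneg j
    set r := R + j with hr
    have hr1 : 1 ≤ r := by linarith
    have hr0 : 0 < r := by linarith
    set ℓ := M * r ^ (1 - p) with hℓ
    have hℓ0 : 0 < ℓ := mul_pos hM (Real.rpow_pos_of_pos hr0 _)
    have hℓ1 : 24 * ℓ ≤ 1 := by
      rw [hℓ, ← mul_assoc]
      exact rpow_one_sub_mul_le hp hr1 (by linarith)
    have hℓsq : ℓ ^ 2 ≤ M ^ 2 * R ^ (2 - 2 * p) := by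
      rw [hℓ, mul_pow]
      refine mul_le_mul_of_nonneg_left ?_ (sq_nonneg M)
      rw [← Real.rpow_natCast, ← Real.rpow_mul hr0.le]
      rw [show (1 - p) * ((2 : ℕ) : ℝ) = 2 - 2 * p by push_cast; ring]
      exact Real.rpow_le_rpow_of_nonpos hR0 (by linarith) (by linarith)
    have hset : {x | r - 1 ≤ dH x ∧ dH x < r + 2} ⊆
        {x | R - 1 + j ≤ dH x ∧ dH x < R - 1 + j + 3} := by
      rintro x ⟨h1, h2⟩
      constructor <;> linarith
    have := setLIntegral_shell_le hf hℓ0 hℓ1 hr1 (measurable_hweight (β := β) (p := p) (by linarith))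
      (e := ENNReal.ofReal (1 / (24 * 96 ^ 4))) (K := ENNReal.ofReal Kr) (by
        intro x z hx hz
        rw [← hMe]
        refine hweight_le_mul ?_
        have h1 := mul_rpow_le_rpow_sub_rpow (dH_nonneg z) (by positivity) hz
          (by linarith : (1 : ℝ) ≤ p)
        have h2 : r ^ (p - 1) ≤ dH x ^ (p - 1) := Real.rpow_le_rpow hr0.le hx (by linarith)
        have h3 : ℓ / 4 * r ^ (p - 1) = M / 4 := by
          rw [hℓ, show M * r ^ (1 - p) / 4 * r ^ (p - 1) = M / 4 * (r ^ (1 - p) * r ^ (p - 1)) by ring,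
            ← Real.rpow_add hr0]
          simp
        have h4 : ℓ / 4 * r ^ (p - 1) ≤ ℓ / 4 * dH x ^ (p - 1) :=
          mul_le_mul_of_nonneg_left h2 (by positivity)
        nlinarith [h1, h3, h4]) (by
        intro x z hx hx' hxz
        have hxz' := abs_le.1 hxz
        refine hweight_le_mul_of_abs_sub_le hβ.le (by linarith) (r := r) hr0 (by linarith)
          (by linarith [hxz'.2]) (hxz.trans (le_of_eq ?_))
        rw [hℓ]; ring)
    refine this.trans ?_
    rw [← mul_assoc, ← mul_assoc, mul_assoc (96 ^ 4 * 2), ← mul_assoc]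
    refine add_le_add (mul_le_mul_right (lintegral_mono_set hset) _) ?_
    calc _ = 96 ^ 4 * 2 * ENNReal.ofReal (65536 * ℓ ^ 2) * ENNReal.ofReal Kr *
          ∫⁻ x in {x | r - 1 ≤ dH x ∧ dH x < r + 2}, ENNReal.ofReal (gradSq heisA f x) * w x := by
            ring
      _ ≤ _ := by
        gcongr
  have hcover : {x | R ≤ dH x} ⊆ ⋃ j : ℕ, {x | R + j ≤ dH x ∧ dH x < R + j + 1} := by
    intro x hx
    rw [Set.mem_ofPred_eq] at hx
    refine Set.mem_iUnion.2 ⟨⌊dH x - R⌋₊, ?_, ?_⟩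
    · linarith [Nat.floor_le (by linarith : 0 ≤ dH x - R)]
    · linarith [Nat.lt_floor_add_one (dH x - R)]
  calc _ ≤ ∑' j : ℕ, ∫⁻ x in {x | R + j ≤ dH x ∧ dH x < R + j + 1},
          ENNReal.ofReal (f x ^ 2) * w x := (lintegral_mono_set hcover).trans (lintegral_iUnion_le _ _)
    _ ≤ _ := ENNReal.tsum_le_tsum hshell
    _ ≤ 96 ^ 4 * 2 * ENNReal.ofReal (1 / (24 * 96 ^ 4)) * (3 * A) +
        96 ^ 4 * 2 * ENNReal.ofReal (65536 * (M ^ 2 * R ^ (2 - 2 * p))) * ENNReal.ofReal Kr *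
          (3 * G) := by
        rw [ENNReal.tsum_add, ENNReal.tsum_mul_left, ENNReal.tsum_mul_left]
        exact add_le_add (mul_le_mul_right (tsum_setLIntegral_shell_le _ _) _)
          (mul_le_mul_right (tsum_setLIntegral_shell_le _ _) _)
    _ = _ := by
        have hRp : 0 ≤ R ^ (2 - 2 * p) := Real.rpow_nonneg hR0.le _
        have e96 : (96 : ENNReal) ^ 4 * 2 = ENNReal.ofReal (96 ^ 4 * 2) := by
          rw [ENNReal.ofReal_mul (by norm_num), ENNReal.ofReal_pow (by norm_num)]; simp
        have e3 : (3 : ENNReal) = ENNReal.ofReal 3 := by simp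
        rw [e96, e3, ← mul_assoc, ← mul_assoc, ← ENNReal.ofReal_mul (by norm_num),
          ← ENNReal.ofReal_mul (by norm_num), ← ENNReal.ofReal_mul (by norm_num),
          ← ENNReal.ofReal_mul (by positivity), ← ENNReal.ofReal_mul (by positivity)]
        have a1 : (96 : ℝ) ^ 4 * 2 * (1 / (24 * 96 ^ 4)) * 3 = 1 / 4 := by norm_num
        have a2 : 96 ^ 4 * 2 * (65536 * (M ^ 2 * R ^ (2 - 2 * p))) * Kr * 3 =
            96 ^ 4 * 2 * 65536 * 3 * M ^ 2 * Kr * R ^ (2 - 2 * p) := by ring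
        rw [a1, a2]

theorem ofReal_sq_mul_le_of_volume_le {f : (Fin 3 → ℝ) → ℝ} (hf : Measurable f) {x : Fin 3 → ℝ}
    {ρ R : ℝ} (hρ : 0 ≤ ρ) (hρ1 : 12 * ρ ≤ 1) (hx : dH x ≤ R)
    (hN : volume {z | dH z ≤ R + 1 ∧ f z ≠ 0} ≤ ENNReal.ofReal (4 * ρ ^ 4)) :
    ENNReal.ofReal (f x ^ 2) * ENNReal.ofReal (4 * ρ ^ 4) ≤
      ∫⁻ h in hbox ρ, ENNReal.ofReal ((f (hmul x h) - f x) ^ 2) := by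
  set N := {z | dH z ≤ R + 1 ∧ f z ≠ 0} with hNdef
  have hNm : MeasurableSet N := (measurableSet_le measurable_dH measurable_const).inter
    (hf (measurableSet_singleton 0).compl)
  have hxm := measurePreserving_hmul_left x
  set P := (fun h => hmul x h) ⁻¹' N with hP
  have hPm : MeasurableSet P := hxm.measurable hNm
  have hv1 : volume (hbox ρ ∩ P) ≤ ENNReal.ofReal (4 * ρ ^ 4) := by
    refine (measure_mono Set.inter_subset_right).trans ?_
    rwa [hP, hxm.measure_preimage hNm.nullMeasurableSet]
  have hv0 : ENNReal.ofReal (4 * ρ ^ 4) ≤ volume (hbox ρ \ P) := by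
    have h1 := measure_inter_add_sdiff (μ := volume) (hbox ρ) hPm
    rw [volume_hbox ρ hρ, show 8 * ρ ^ 4 = 4 * ρ ^ 4 + 4 * ρ ^ 4 by ring,
      ENNReal.ofReal_add (by positivity) (by positivity)] at h1
    have h2 : ENNReal.ofReal (4 * ρ ^ 4) + ENNReal.ofReal (4 * ρ ^ 4) ≤
        ENNReal.ofReal (4 * ρ ^ 4) + volume (hbox ρ \ P) := by
      rw [← h1]
      exact add_le_add hv1 le_rfl
    exact (ENNReal.add_le_add_iff_left ENNReal.ofReal_ne_top).1 h2
  calc _ ≤ ENNReal.ofReal (f x ^ 2) * volume (hbox ρ \ P) := mul_le_mul_right hv0 _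
    _ = ∫⁻ h in hbox ρ \ P, ENNReal.ofReal (f x ^ 2) := (setLIntegral_const _ _).symm
    _ ≤ ∫⁻ h in hbox ρ \ P, ENNReal.ofReal ((f (hmul x h) - f x) ^ 2) := by
        refine setLIntegral_mono' ((measurableSet_hbox ρ).diff hPm) fun h hh => ?_
        have hz : f (hmul x h) = 0 := by
          by_contra hne
          refine hh.2 ⟨?_, hne⟩
          have := abs_le.1 (abs_dH_hmul_sub_le hρ hh.1 x)
          linarith [this.2]
        rw [hz, zero_sub, neg_sq]
    _ ≤ _ := lintegral_mono_set Set.sdiff_subset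

theorem setLIntegral_near_le {f : (Fin 3 → ℝ) → ℝ} (hf : ContDiff ℝ 1 f) {ρ R : ℝ}
    (hρ : 0 < ρ) (hρ1 : 12 * ρ ≤ 1)
    (hN : volume {z | dH z ≤ R + 1 ∧ f z ≠ 0} ≤ ENNReal.ofReal (4 * ρ ^ 4))
    {w : (Fin 3 → ℝ) → ENNReal} (hw : Measurable w) {K : ENNReal}
    (hcomp : ∀ x z, dH x < R → |dH z - dH x| ≤ 12 * ρ → w x ≤ K * w z) :
    ∫⁻ x in {x | dH x < R}, ENNReal.ofReal (f x ^ 2) * w x ≤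
      2 * (ENNReal.ofReal (16384 * ρ ^ 2) * (K *
        ∫⁻ x, ENNReal.ofReal (gradSq heisA f x) * w x)) := by
  set B := {x | dH x < R}
  have hBm : MeasurableSet B := measurableSet_lt measurable_dH measurable_const
  have hfm := hf.continuous.measurable
  set D := ENNReal.ofReal (16384 * ρ ^ 2) * (K * ∫⁻ x, ENNReal.ofReal (gradSq heisA f x) * w x)
  have hin : ∀ h ∈ hbox ρ, ∫⁻ x, ENNReal.ofReal ((f (hmul x h) - f x) ^ 2) * B.indicator w x ≤ D := by
    intro h hh
    refine (lintegral_sq_sub_hmul_le hf hρ.le hh (hw.indicator hBm) (hw.const_mul K) ?_).trans ?_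
    · intro x z hxz
      by_cases hx : x ∈ B
      · rw [Set.indicator_of_mem hx]
        exact hcomp x z hx hxz
      · rw [Set.indicator_of_notMem hx]
        exact zero_le
    · refine mul_le_mul_right (le_of_eq ?_) _
      have hg : Measurable fun x => ENNReal.ofReal (gradSq heisA f x) * w x :=
        (continuous_gradSq hf).measurable.ennreal_ofReal.mul hw
      rw [← lintegral_const_mul _ hg]
      congr 1
      funext x
      ring
  have hsw : Measurable fun x => ENNReal.ofReal (f x ^ 2) * w x :=
    (hfm.pow_const 2).ennreal_ofReal.mul hw
  have hm : Measurable fun q : (Fin 3 → ℝ) × (Fin 3 → ℝ) =>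
      ENNReal.ofReal ((f (hmul q.1 q.2) - f q.1) ^ 2) * B.indicator w q.1 :=
    (((hfm.comp measurable_hmul).sub (hfm.comp measurable_fst)).pow_const 2).ennreal_ofReal.mul
      ((hw.indicator hBm).comp measurable_fst)
  have hv0 : ENNReal.ofReal (4 * ρ ^ 4) ≠ 0 := by
    simp only [ne_eq, ENNReal.ofReal_eq_zero, not_le]
    positivity
  rw [← ENNReal.mul_le_mul_iff_right hv0 ENNReal.ofReal_ne_top, mul_comm,
    ← lintegral_mul_const _ hsw]
  have hpt : ∀ x ∈ B, ENNReal.ofReal (f x ^ 2) * w x * ENNReal.ofReal (4 * ρ ^ 4) ≤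
      ∫⁻ h in hbox ρ, ENNReal.ofReal ((f (hmul x h) - f x) ^ 2) * B.indicator w x := by
    intro x hx
    rw [Set.indicator_of_mem hx]
    refine le_trans (le_of_eq (by ring)) ((mul_le_mul_left
      (ofReal_sq_mul_le_of_volume_le hfm hρ.le hρ1 (le_of_lt hx) hN) (w x)).trans ?_)
    exact lintegral_mul_const_le _ _
  refine (setLIntegral_mono' hBm hpt).trans ((setLIntegral_le_lintegral _ _).trans ?_)
  rw [lintegral_lintegral_swap hm.aemeasurable]
  refine (setLIntegral_mono' (measurableSet_hbox _) hin).trans (le_of_eq ?_)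
  rw [setLIntegral_const, volume_hbox ρ hρ.le, show 8 * ρ ^ 4 = 2 * (4 * ρ ^ 4) by ring,
    ENNReal.ofReal_mul zero_le_two]
  simp only [ENNReal.ofReal_ofNat]
  ring

theorem ENNReal.le_two_mul_of_le_quarter_mul_add {a b : ENNReal} (ha : a ≠ ⊤)
    (h : a ≤ ENNReal.ofReal (1 / 4) * a + b) : a ≤ 2 * b := by
  rcases eq_or_ne b ⊤ with rfl | hb
  · simp
  lift a to NNReal using ha
  lift b to NNReal using hb
  rw [ENNReal.ofReal] at h
  norm_cast at h ⊢
  rw [← NNReal.coe_le_coe] at h ⊢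
  push_cast at h ⊢
  rw [Real.coe_toNNReal _ (by norm_num)] at h
  linarith [a.2, b.2]

theorem exists_faberKrahn_radius {β p : ℝ} (hβ : 0 < β) (hp : 2 ≤ p) :
    ∃ C R₀ : ℝ, 0 < C ∧ 1 ≤ R₀ ∧ ∀ R, R₀ ≤ R → ∀ f : (Fin 3 → ℝ) → ℝ, ContDiff ℝ 1 f →
      ∫⁻ x, ENNReal.ofReal (f x ^ 2) * hweight β p x ≠ ⊤ →
      ∫⁻ x in {x | f x ≠ 0}, hweight β p x ≤
        ENNReal.ofReal (4 * (R ^ (1 - p) / 24) ^ 4 * Real.exp (-(β * (R + 1) ^ p))) →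
      ∫⁻ x, ENNReal.ofReal (f x ^ 2) * hweight β p x ≤ ENNReal.ofReal (C * R ^ (2 - 2 * p)) *
          ∫⁻ x, ENNReal.ofReal (gradSq heisA f x) * hweight β p x := by
  obtain ⟨C, R₀, hC, hR₀, hfar⟩ := exists_setLIntegral_far_le hβ hp
  set Kr := Real.exp (β * (p * 2 ^ (p - 1) * (1 / 2))) with hKr
  have hKpos : 0 < Kr := Real.exp_pos _
  refine ⟨2 * (2 * 16384 / 576 * Kr + C), R₀, by positivity, hR₀, ?_⟩
  intro R hR f hf hfin hsupp
  have hR1 : 1 ≤ R := hR₀.trans hR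
  have hR0 : 0 < R := by linarith
  set ρ := R ^ (1 - p) / 24 with hρ
  have hRp : 0 < R ^ (1 - p) := Real.rpow_pos_of_pos hR0 _
  have hρ0 : 0 < ρ := by positivity
  have hRle : R ^ (1 - p) ≤ 1 := by simpa using rpow_one_sub_mul_le hp hR1 (M := 1) hR1
  have hρsq : ρ ^ 2 = R ^ (2 - 2 * p) / 576 := by
    rw [hρ, div_pow, ← Real.rpow_natCast, ← Real.rpow_mul hR0.le]
    norm_num
    ring_nf
  set w := hweight β p with hw
  have hwm : Measurable w := measurable_hweight (by linarith)
  set A := ∫⁻ x, ENNReal.ofReal (f x ^ 2) * w x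
  set G := ∫⁻ x, ENNReal.ofReal (gradSq heisA f x) * w x
  have hN : volume {z | dH z ≤ R + 1 ∧ f z ≠ 0} ≤ ENNReal.ofReal (4 * ρ ^ 4) := by
    have hNm : MeasurableSet {z | dH z ≤ R + 1 ∧ f z ≠ 0} :=
      (measurableSet_le measurable_dH measurable_const).inter
        (hf.continuous.measurable (measurableSet_singleton 0).compl)
    have h1 : ENNReal.ofReal (Real.exp (-(β * (R + 1) ^ p))) *
        volume {z | dH z ≤ R + 1 ∧ f z ≠ 0} ≤ ∫⁻ x in {x | f x ≠ 0}, w x := by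
      rw [← setLIntegral_const]
      refine (setLIntegral_mono' hNm fun z hz => ?_).trans
        (lintegral_mono_set fun z hz => hz.2)
      refine ENNReal.ofReal_le_ofReal (Real.exp_le_exp.2 (neg_le_neg ?_))
      exact mul_le_mul_of_nonneg_left
        (Real.rpow_le_rpow (dH_nonneg z) hz.1 (by linarith)) hβ.le
    have h2 := h1.trans hsupp
    rw [mul_comm (4 * ρ ^ 4), ENNReal.ofReal_mul (Real.exp_pos _).le] at h2
    exact (ENNReal.mul_le_mul_iff_right (by simp [Real.exp_pos]) ENNReal.ofReal_ne_top).1 h2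
  have hnear := setLIntegral_near_le hf hρ0 (by rw [hρ]; linarith) hN hwm
    (K := ENNReal.ofReal Kr) (by
      intro x z hx hxz
      have hxz' := abs_le.1 hxz
      refine hweight_le_mul_of_abs_sub_le hβ.le (by linarith) (r := R) hR0 (by linarith)
        (by linarith [hxz'.2]) (hxz.trans (le_of_eq ?_))
      rw [hρ]; ring)
  have hsplit : A ≤ (∫⁻ x in {x | dH x < R}, ENNReal.ofReal (f x ^ 2) * w x) +
      ∫⁻ x in {x | R ≤ dH x}, ENNReal.ofReal (f x ^ 2) * w x := by
    have hc : {x : Fin 3 → ℝ | R ≤ dH x} = {x | dH x < R}ᶜ := by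
      ext x; simp
    rw [hc, lintegral_add_compl _ (measurableSet_lt measurable_dH measurable_const)]
  have hRpp : 0 ≤ R ^ (2 - 2 * p) := Real.rpow_nonneg hR0.le _
  have hall : A ≤ ENNReal.ofReal (1 / 4) * A +
      ENNReal.ofReal ((2 * 16384 / 576 * Kr + C) * R ^ (2 - 2 * p)) * G := by
    refine hsplit.trans ((add_le_add hnear (hfar R hR f hf)).trans (le_of_eq ?_))
    rw [add_mul, ENNReal.ofReal_add (by positivity) (by positivity), hρsq, add_mul,
      show 2 * 16384 / 576 * Kr * R ^ (2 - 2 * p) =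
        2 * (16384 * (R ^ (2 - 2 * p) / 576)) * Kr by ring,
      ENNReal.ofReal_mul (p := 2 * (16384 * (R ^ (2 - 2 * p) / 576))) (by positivity),
      ENNReal.ofReal_mul (p := 2) zero_le_two]
    simp only [ENNReal.ofReal_ofNat]
    ring
  refine (ENNReal.le_two_mul_of_le_quarter_mul_add hfin hall).trans (le_of_eq ?_)
  rw [mul_assoc 2 (_ + C), ENNReal.ofReal_mul zero_le_two, mul_assoc]
  simp

/-- Faber–Krahn type inequality: functions supported on a set of Gibbs measure `4⁻ⁿ` satisfy a
spectral gap of order `n`. -/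
theorem exists_faberKrahn {β p : ℝ} (hβ : 0 < β) (hp : 2 ≤ p) (Z : ℝ) :
    ∃ C : ℝ, ∃ n₀ : ℕ, 0 < C ∧ ∀ n : ℕ, n₀ ≤ n → ∀ f : (Fin 3 → ℝ) → ℝ, ContDiff ℝ 1 f →
      ∫⁻ x, ENNReal.ofReal (f x ^ 2) * hweight β p x ≠ ⊤ →
      ∫⁻ x in {x | f x ≠ 0}, hweight β p x ≤ ENNReal.ofReal ((1 / 4) ^ n * Z) →
      n * ∫⁻ x, ENNReal.ofReal (f x ^ 2) * hweight β p x ≤ ENNReal.ofReal C *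
          ∫⁻ x, ENNReal.ofReal (gradSq heisA f x) * hweight β p x := by
  obtain ⟨C, R₀, hC, hR₀, hFK⟩ := exists_faberKrahn_radius hβ hp
  have hp0 : 0 < p := by linarith
  set c : ℝ := 1 / (β * 2 ^ p) with hc
  have hc0 : 0 < c := by positivity
  have hlim1 : Tendsto (fun n : ℕ => (c * n) ^ (1 / p)) atTop atTop :=
    (tendsto_rpow_atTop (by positivity)).comp
      (tendsto_natCast_atTop_atTop.const_mul_atTop hc0)
  have hexp : Real.exp 1 < 4 := by linarith [Real.exp_one_lt_d9]
  have hlim2 : Tendsto (fun n : ℕ => (Z * 24 ^ 4 / 4 * c ^ 4) *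
      ((n : ℝ) ^ 4 * (Real.exp 1 / 4) ^ n)) atTop (nhds 0) := by
    have := (tendsto_pow_const_mul_const_pow_of_abs_lt_one 4 (r := Real.exp 1 / 4) (by
      rw [abs_of_pos (by positivity)]; linarith)).const_mul (Z * 24 ^ 4 / 4 * c ^ 4)
    simpa using this
  obtain ⟨n₀, hn₀⟩ := eventually_atTop.1 ((hlim1.eventually_ge_atTop R₀).and
    ((hlim2.eventually_le_const one_pos).and (eventually_ge_atTop 1)))
  refine ⟨C / c, n₀, by positivity, fun n hn f hf hfin hsupp => ?_⟩
  obtain ⟨hR, hsmall, hn1⟩ := hn₀ n hn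
  have hn0 : (0 : ℝ) < n := by exact_mod_cast hn1
  set R := (c * n) ^ (1 / p) with hRdef
  have hR1 : 1 ≤ R := hR₀.trans hR
  have hR0 : 0 < R := by linarith
  have hRp : R ^ p = c * n := by
    rw [hRdef, ← Real.rpow_mul (by positivity), one_div_mul_cancel hp0.ne', Real.rpow_one]
  have hcond : (1 / 4) ^ n * Z ≤
      4 * (R ^ (1 - p) / 24) ^ 4 * Real.exp (-(β * (R + 1) ^ p)) := by
    have h1 : β * (R + 1) ^ p ≤ n := by
      calc β * (R + 1) ^ p ≤ β * (2 * R) ^ p := by gcongr; linarith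
        _ = n := by
          rw [Real.mul_rpow zero_le_two hR0.le, hRp, hc]
          field_simp
    have h2 : Real.exp (-(n : ℝ)) ≤ Real.exp (-(β * (R + 1) ^ p)) :=
      Real.exp_le_exp.2 (neg_le_neg h1)
    have h3 : ((c * n) ^ 4)⁻¹ ≤ (R ^ (1 - p)) ^ 4 := by
      rw [← hRp, ← inv_pow, ← Real.rpow_neg hR0.le]
      exact pow_le_pow_left₀ (Real.rpow_nonneg hR0.le _)
        (Real.rpow_le_rpow_of_exponent_le hR1 (by linarith)) 4
    have h4 : Real.exp 1 ^ n * Real.exp (-(n : ℝ)) = 1 := by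
      rw [← Real.exp_nat_mul, ← Real.exp_add]; simp
    calc (1 / 4) ^ n * Z
        = (Z * 24 ^ 4 / 4 * c ^ 4 * ((n : ℝ) ^ 4 * (Real.exp 1 / 4) ^ n)) *
          (4 * (((c * n) ^ 4)⁻¹ / 24 ^ 4) * Real.exp (-(n : ℝ))) := by
          have h5 : (Real.exp 1 / 4) ^ n = (1 / 4) ^ n * Real.exp 1 ^ n := by
            rw [div_pow, one_div_pow]; ring
          have h6 : (c * n) ^ 4 * ((c * n) ^ 4)⁻¹ = 1 := mul_inv_cancel₀ (by positivity)
          rw [h5]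
          linear_combination (-(Z * (1 / 4) ^ n * (Real.exp 1 ^ n * Real.exp (-(n : ℝ))))) * h6 -
            Z * (1 / 4) ^ n * h4
      _ ≤ 1 * (4 * (((c * n) ^ 4)⁻¹ / 24 ^ 4) * Real.exp (-(n : ℝ))) :=
          mul_le_mul_of_nonneg_right hsmall (by positivity)
      _ ≤ _ := by
          rw [one_mul, div_pow]
          gcongr
  have hmain := hFK R hR f hf hfin (hsupp.trans (ENNReal.ofReal_le_ofReal hcond))
  have hRpow : R ^ (2 - 2 * p) ≤ (c * n)⁻¹ := by
    rw [← hRp, ← Real.rpow_neg hR0.le]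
    exact Real.rpow_le_rpow_of_exponent_le hR1 (by linarith)
  calc _ ≤ (n : ENNReal) * (ENNReal.ofReal (C * (c * n)⁻¹) *
        ∫⁻ x, ENNReal.ofReal (gradSq heisA f x) * hweight β p x) := by
        refine mul_le_mul_right (hmain.trans (mul_le_mul_left (ENNReal.ofReal_le_ofReal ?_) _)) _
        exact mul_le_mul_of_nonneg_left hRpow hC.le
    _ = _ := by
        rw [← mul_assoc, ← ENNReal.ofReal_natCast, ← ENNReal.ofReal_mul hn0.le]
        congr 2
        field_simp

theorem lintegral_hweight_ne_top {β p : ℝ} (hβ : 0 < β) (hp : 1 ≤ p) :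
    ∫⁻ x, hweight β p x ≠ ⊤ := by
  have hshell : ∀ j : ℕ, ∫⁻ x in {x | (j : ℝ) ≤ dH x ∧ dH x < j + 1}, hweight β p x ≤
      ENNReal.ofReal (Real.exp β * 8 * (((j + 1 : ℕ) : ℝ) ^ 4 * Real.exp (-β) ^ (j + 1))) := by
    intro j
    have hj : (0 : ℝ) ≤ j := Nat.cast_nonneg j
    have hm : MeasurableSet {x | (j : ℝ) ≤ dH x ∧ dH x < j + 1} :=
      (measurableSet_le measurable_const measurable_dH).inter
        (measurableSet_lt measurable_dH measurable_const)
    calc _ ≤ ∫⁻ x in {x | (j : ℝ) ≤ dH x ∧ dH x < j + 1}, ENNReal.ofReal (Real.exp (-(β * j))) := by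
          refine setLIntegral_mono' hm fun x hx => ENNReal.ofReal_le_ofReal (Real.exp_le_exp.2 ?_)
          refine neg_le_neg (mul_le_mul_of_nonneg_left ?_ hβ.le)
          have h1 : (j : ℝ) ≤ (j : ℝ) ^ p := by
            rcases Nat.eq_zero_or_pos j with rfl | hpos
            · simp [Real.zero_rpow (by linarith : p ≠ 0)]
            · exact Real.self_le_rpow_of_one_le (by exact_mod_cast hpos) hp
          exact h1.trans (Real.rpow_le_rpow hj hx.1 (by linarith))
      _ = ENNReal.ofReal (Real.exp (-(β * j))) * volume {x | (j : ℝ) ≤ dH x ∧ dH x < j + 1} :=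
          setLIntegral_const _ _
      _ ≤ ENNReal.ofReal (Real.exp (-(β * j))) * volume (hbox (j + 1)) := by
          refine mul_le_mul_right (measure_mono fun x hx => ?_) _
          exact hbox_mono (dH_nonneg x) hx.2.le (mem_hbox_dH x)
      _ = _ := by
          rw [volume_hbox _ (by positivity), ← ENNReal.ofReal_mul (Real.exp_pos _).le,
            ← Real.exp_nat_mul]
          congr 1
          have : Real.exp (-(β * j)) = Real.exp β * Real.exp (((j + 1 : ℕ) : ℝ) * -β) := by
            rw [← Real.exp_add]; congr 1; push_cast; ring
          rw [this]
          push_cast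
          ring
  have hcover : (Set.univ : Set (Fin 3 → ℝ)) ⊆
      ⋃ j : ℕ, {x | (j : ℝ) ≤ dH x ∧ dH x < j + 1} := fun x _ =>
    Set.mem_iUnion.2 ⟨⌊dH x⌋₊, Nat.floor_le (dH_nonneg x), Nat.lt_floor_add_one _⟩
  have hsum : Summable fun j : ℕ =>
      Real.exp β * 8 * (((j + 1 : ℕ) : ℝ) ^ 4 * Real.exp (-β) ^ (j + 1)) := by
    have h0 : Summable fun n : ℕ => (n : ℝ) ^ 4 * Real.exp (-β) ^ n := by
      refine summable_pow_mul_geometric_of_norm_lt_one 4 ?_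
      rw [Real.norm_eq_abs, abs_of_pos (Real.exp_pos _)]
      exact Real.exp_lt_one_iff.2 (by linarith)
    have h1 := h0.comp_injective (add_left_injective 1)
    exact h1.mul_left (Real.exp β * 8)
  refine ne_top_of_le_ne_top hsum.tsum_ofReal_ne_top ?_
  calc ∫⁻ x, hweight β p x = ∫⁻ x in Set.univ, hweight β p x := by simp
    _ ≤ _ := (lintegral_mono_set hcover).trans ((lintegral_iUnion_le _ _).trans
      (ENNReal.tsum_le_tsum hshell))

theorem gradSq_sub_const (f : (Fin 3 → ℝ) → ℝ) (c : ℝ) :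
    gradSq heisA (fun x => f x - c) = gradSq heisA f := by
  funext x
  simp [gradSq, Xop, fderiv_sub_const]

theorem hdiv_mem_hbox_two_mul {R : ℝ} {x y : Fin 3 → ℝ} (hx : x ∈ hbox R)
    (hy : y ∈ hbox R) : hdiv y x ∈ hbox (2 * R) := by
  obtain ⟨x0, x1, x2⟩ := hx
  obtain ⟨y0, y1, y2⟩ := hy
  have hR : 0 ≤ R := (abs_nonneg _).trans x0
  refine ⟨?_, ?_, ?_⟩
  · rw [hdiv_zero']
    exact (abs_sub _ _).trans (by linarith)
  · rw [hdiv_one']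
    exact (abs_sub _ _).trans (by linarith)
  · rw [hdiv_two']
    have a1 := abs_sub (x 2 - y 2) ((y 0 * x 1 - y 1 * x 0) / 2)
    have a2 := abs_sub (x 2) (y 2)
    have a3 := abs_sub (y 0 * x 1) (y 1 * x 0)
    have a4 : |y 0 * x 1| ≤ R * R := by
      rw [abs_mul]; exact mul_le_mul y0 x1 (abs_nonneg _) hR
    have a5 : |y 1 * x 0| ≤ R * R := by
      rw [abs_mul]; exact mul_le_mul y1 x0 (abs_nonneg _) hR
    rw [abs_div, abs_two] at a1
    nlinarith

/-- Poincaré inequality with an unspecified centring constant. -/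
theorem exists_poincare {β p : ℝ} (hβ : 0 < β) (hp : 2 ≤ p) :
    ∃ C : ℝ, 0 < C ∧ ∀ f : (Fin 3 → ℝ) → ℝ, ContDiff ℝ 1 f →
      ∫⁻ x, ENNReal.ofReal (f x ^ 2) * hweight β p x ≠ ⊤ →
      ∃ a : ℝ, ∫⁻ x, ENNReal.ofReal ((f x - a) ^ 2) * hweight β p x ≤
        ENNReal.ofReal C * ∫⁻ x, ENNReal.ofReal (gradSq heisA f x) * hweight β p x := by
  obtain ⟨C₁, R, hC₁, hR1, hfar⟩ := exists_setLIntegral_far_le hβ hp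
  have hR0 : 0 < R := by linarith
  set B := {x | dH x < R} with hB
  have hBm : MeasurableSet B := measurableSet_lt measurable_dH measurable_const
  have hBsub : B ⊆ hbox R := fun x hx => hbox_mono (dH_nonneg x) (le_of_lt hx) (mem_hbox_dH x)
  have hB0 : volume B ≠ 0 := by
    have hsub : hbox (R / 13) ⊆ B := by
      intro x hx
      have := abs_le.1 (abs_dH_hmul_sub_le (by positivity) hx 0)
      rw [hmul_zero_left, dH_zero] at this
      rw [hB, Set.mem_ofPred_eq]
      linarith [this.2]
    refine fun h0 => absurd (measure_mono_null hsub h0) ?_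
    rw [volume_hbox _ (by positivity), ENNReal.ofReal_eq_zero, not_le]
    positivity
  have hBt : volume B ≠ ⊤ := by
    refine ne_top_of_le_ne_top ?_ (measure_mono hBsub)
    rw [volume_hbox _ hR0.le]
    exact ENNReal.ofReal_ne_top
  set K := Real.exp (β * (25 * R) ^ p) with hK
  have hK0 : 0 < K := Real.exp_pos _
  set v := (volume B).toReal with hv
  have hv0 : 0 < v := ENNReal.toReal_pos hB0 hBt
  have hRp : 0 < R ^ (2 - 2 * p) := Real.rpow_pos_of_pos hR0 _
  set C₂ := 8 * (2 * R) ^ 4 * (16384 * (2 * R) ^ 2) * K / v with hC₂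
  refine ⟨2 * (C₂ + C₁ * R ^ (2 - 2 * p)), by positivity, fun f hf hfin => ?_⟩
  have hfm := hf.continuous.measurable
  set w := hweight β p with hw
  have hwm : Measurable w := measurable_hweight (by linarith)
  set G := ∫⁻ x, ENNReal.ofReal (gradSq heisA f x) * w x with hG
  have hlocal : ∫⁻ y in B, ∫⁻ x in B, ENNReal.ofReal ((f x - f y) ^ 2) ≤
      volume B * (ENNReal.ofReal C₂ * G) := by
    have hpt : ∀ y ∈ B, ∫⁻ x in B, ENNReal.ofReal ((f x - f y) ^ 2) ≤
        ∫⁻ h in hbox (2 * R), ENNReal.ofReal ((f (hmul y h) - f y) ^ 2) * B.indicator 1 y := by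
      intro y hy
      have hm : Measurable fun x => ENNReal.ofReal ((f x - f y) ^ 2) :=
        ((hfm.sub_const _).pow_const 2).ennreal_ofReal
      rw [← lintegral_indicator hBm, ← lintegral_indicator (measurableSet_hbox _),
        ← (measurePreserving_hmul_left y).lintegral_comp (hm.indicator hBm)]
      refine lintegral_mono fun h => ?_
      by_cases hh : hmul y h ∈ B
      · have : h ∈ hbox (2 * R) := by
          rw [← hdiv_hmul y h]
          exact hdiv_mem_hbox_two_mul (hBsub hh) (hBsub hy)
        rw [Set.indicator_of_mem hh, Set.indicator_of_mem this, Set.indicator_of_mem hy]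
        simp
      · rw [Set.indicator_of_notMem hh]
        exact zero_le
    refine (setLIntegral_mono' hBm hpt).trans ((setLIntegral_le_lintegral _ _).trans ?_)
    have hm : Measurable fun q : (Fin 3 → ℝ) × (Fin 3 → ℝ) =>
        ENNReal.ofReal ((f (hmul q.1 q.2) - f q.1) ^ 2) *
          B.indicator (1 : (Fin 3 → ℝ) → ENNReal) q.1 :=
      (((hfm.comp measurable_hmul).sub (hfm.comp measurable_fst)).pow_const 2).ennreal_ofReal.mul
        ((measurable_one.indicator hBm).comp measurable_fst)
    rw [lintegral_lintegral_swap hm.aemeasurable]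
    have hin : ∀ h ∈ hbox (2 * R), ∫⁻ x, ENNReal.ofReal ((f (hmul x h) - f x) ^ 2) *
        B.indicator 1 x ≤ ENNReal.ofReal (16384 * (2 * R) ^ 2) * (ENNReal.ofReal K * G) := by
      intro h hh
      refine (lintegral_sq_sub_hmul_le hf (by positivity) hh (measurable_one.indicator hBm)
        (hwm.const_mul (ENNReal.ofReal K)) ?_).trans ?_
      · intro x z hxz
        by_cases hx : x ∈ B
        · rw [Set.indicator_of_mem hx, hw, hweight, ← ENNReal.ofReal_mul hK0.le, hK,
            ← Real.exp_add, Pi.one_apply, ← ENNReal.ofReal_one]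
          refine ENNReal.ofReal_le_ofReal (Real.one_le_exp ?_)
          have hx' : dH x < R := hx
          have h1 : dH z ^ p ≤ (25 * R) ^ p := Real.rpow_le_rpow (dH_nonneg z)
            (by linarith [(abs_le.1 hxz).2]) (by linarith)
          nlinarith
        · rw [Set.indicator_of_notMem hx]
          exact zero_le
      · refine mul_le_mul_right (le_of_eq ?_) _
        have hg : Measurable fun x => ENNReal.ofReal (gradSq heisA f x) * w x :=
          (continuous_gradSq hf).measurable.ennreal_ofReal.mul hwm
        rw [hG, ← lintegral_const_mul _ hg]
        congr 1
        funext x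
        ring
    refine (setLIntegral_mono' (measurableSet_hbox _) hin).trans (le_of_eq ?_)
    have hvB : volume B = ENNReal.ofReal v := (ENNReal.ofReal_toReal hBt).symm
    rw [setLIntegral_const, volume_hbox _ (by positivity), hvB, ← mul_assoc, ← mul_assoc,
      ← ENNReal.ofReal_mul hv0.le, mul_comm, ← mul_assoc, ← mul_assoc,
      ← ENNReal.ofReal_mul (by positivity), ← ENNReal.ofReal_mul (by positivity)]
    congr 2
    rw [hC₂]
    field_simp
  have hIm : Measurable fun y => ∫⁻ x in B, ENNReal.ofReal ((f x - f y) ^ 2) := by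
    refine Measurable.lintegral_prod_right' (f := fun q : (Fin 3 → ℝ) × (Fin 3 → ℝ) =>
      ENNReal.ofReal ((f q.2 - f q.1) ^ 2)) ?_
    exact (((hfm.comp measurable_snd).sub (hfm.comp measurable_fst)).pow_const 2).ennreal_ofReal
  obtain ⟨y, -, hy⟩ := exists_le_setLAverage hB0 hBt hIm.aemeasurable
  rw [setLAverage_eq] at hy
  have hy' : ∫⁻ x in B, ENNReal.ofReal ((f x - f y) ^ 2) ≤ ENNReal.ofReal C₂ * G := by
    refine hy.trans (ENNReal.div_le_of_le_mul ?_)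
    rw [mul_comm]
    exact hlocal
  refine ⟨f y, ?_⟩
  have hw1 : ∀ x, w x ≤ 1 := by
    intro x
    rw [hw, hweight, ← ENNReal.ofReal_one]
    refine ENNReal.ofReal_le_ofReal (Real.exp_le_one_iff.2 (neg_nonpos.2 ?_))
    exact mul_nonneg hβ.le (Real.rpow_nonneg (dH_nonneg x) _)
  have hfar' := hfar R le_rfl (fun x => f x - f y) (hf.sub contDiff_const)
  rw [gradSq_sub_const] at hfar'
  set A := ∫⁻ x, ENNReal.ofReal ((f x - f y) ^ 2) * w x
  have hsplit : A = (∫⁻ x in B, ENNReal.ofReal ((f x - f y) ^ 2) * w x) +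
      ∫⁻ x in {x | R ≤ dH x}, ENNReal.ofReal ((f x - f y) ^ 2) * w x := by
    have hc : {x : Fin 3 → ℝ | R ≤ dH x} = Bᶜ := by
      ext x; simp [hB]
    rw [hc, lintegral_add_compl _ hBm]
  have hnear : ∫⁻ x in B, ENNReal.ofReal ((f x - f y) ^ 2) * w x ≤ ENNReal.ofReal C₂ * G :=
    (lintegral_mono fun x => mul_le_of_le_one_right zero_le (hw1 x)).trans hy'
  have hAfin : A ≠ ⊤ := by
    refine ne_top_of_le_ne_top (b := 2 * (∫⁻ x, ENNReal.ofReal (f x ^ 2) * w x) +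
      ENNReal.ofReal (2 * f y ^ 2) * ∫⁻ x, w x) ?_ ?_
    · exact ENNReal.add_ne_top.2 ⟨ENNReal.mul_ne_top (by simp) hfin,
        ENNReal.mul_ne_top ENNReal.ofReal_ne_top (lintegral_hweight_ne_top hβ (by linarith))⟩
    · rw [← lintegral_const_mul' _ _ (by simp), ← lintegral_const_mul _ hwm,
        ← lintegral_add_right _ (hwm.const_mul _)]
      refine lintegral_mono fun x => ?_
      simp only
      rw [← mul_assoc, ← add_mul, show (2 : ENNReal) = ENNReal.ofReal 2 by simp,
        ← ENNReal.ofReal_mul zero_le_two, ← ENNReal.ofReal_add (by positivity) (by positivity)]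
      refine mul_le_mul_left (ENNReal.ofReal_le_ofReal ?_) _
      nlinarith [sq_nonneg (f x + f y)]
  have hall : A ≤ ENNReal.ofReal (1 / 4) * A + ENNReal.ofReal (C₂ + C₁ * R ^ (2 - 2 * p)) * G := by
    rw [ENNReal.ofReal_add (by positivity) (by positivity), add_mul]
    calc A = _ := hsplit
      _ ≤ _ := add_le_add hnear hfar'
      _ = _ := by ring
  refine (ENNReal.le_two_mul_of_le_quarter_mul_add hAfin hall).trans (le_of_eq ?_)
  rw [ENNReal.ofReal_mul zero_le_two, mul_assoc]
  simp

theorem gradSq_comp {h : ℝ → ℝ} (hh : ContDiff ℝ 1 h) {f : (Fin 3 → ℝ) → ℝ}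
    (hf : ContDiff ℝ 1 f) (x : Fin 3 → ℝ) :
    gradSq heisA (fun x => h (f x)) x = deriv h (f x) ^ 2 * gradSq heisA f x := by
  have hd : fderiv ℝ (fun x => h (f x)) x = deriv h (f x) • fderiv ℝ f x :=
    ((hh.differentiable one_ne_zero (f x)).hasDerivAt.comp_hasFDerivAt x
      (hf.differentiable one_ne_zero x).hasFDerivAt).fderiv
  simp only [gradSq, xop_eq_fderiv, hd, Finset.mul_sum]
  refine Finset.sum_congr rfl fun k _ => ?_
  simp only [FunLike.coe_smul, Pi.smul_apply, smul_eq_mul]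
  ring

/-- Smooth functions vanishing for `t² ≤ M`, equal to `1` for `t² ≥ 2M`, with the natural bound
on the derivative. -/
theorem exists_cutoff : ∃ D : ℝ, 0 < D ∧ ∀ M : ℝ, 0 < M → ∃ h : ℝ → ℝ, ContDiff ℝ 1 h ∧
    (∀ t, |h t| ≤ 1) ∧ (∀ t, t ^ 2 ≤ M → h t = 0) ∧ (∀ t, 2 * M ≤ t ^ 2 → h t = 1) ∧
    (∀ t, deriv h t ^ 2 ≤ D / M) ∧ ∀ t, ¬(M ≤ t ^ 2 ∧ t ^ 2 ≤ 2 * M) → deriv h t = 0 := by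
  set H : ℝ → ℝ := fun s => Real.smoothTransition (s ^ 2 - 1) with hH
  have hHc : ContDiff ℝ 1 H := Real.smoothTransition.contDiff.comp (by fun_prop)
  have hH0 : ∀ s, s ^ 2 ≤ 1 → H s = 0 := fun s hs =>
    Real.smoothTransition.zero_of_nonpos (by linarith)
  have hH1 : ∀ s, 2 ≤ s ^ 2 → H s = 1 := fun s hs =>
    Real.smoothTransition.one_of_one_le (by linarith)
  have hd0 : ∀ s, ¬(1 ≤ s ^ 2 ∧ s ^ 2 ≤ 2) → deriv H s = 0 := by
    intro s hs
    have hc : Continuous fun s : ℝ => s ^ 2 := continuous_pow 2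
    rcases lt_or_ge (s ^ 2) 1 with h | h
    · have : H =ᶠ[nhds s] fun _ => 0 :=
        eventually_of_mem ((isOpen_Iio.preimage hc).mem_nhds h) fun y hy => hH0 y (le_of_lt hy)
      rw [this.deriv_eq, deriv_const]
    · have h2 : 2 < s ^ 2 := by
        by_contra! h3
        exact hs ⟨h, h3⟩
      have : H =ᶠ[nhds s] fun _ => 1 :=
        eventually_of_mem ((isOpen_Ioi.preimage hc).mem_nhds h2) fun y hy => hH1 y (le_of_lt hy)
      rw [this.deriv_eq, deriv_const]
  obtain ⟨B, hB⟩ := (isCompact_Icc (a := (-2 : ℝ)) (b := 2)).exists_bound_of_continuousOn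
    (hHc.continuous_deriv le_rfl).continuousOn
  have hdB : ∀ s, deriv H s ^ 2 ≤ B ^ 2 + 1 := by
    intro s
    by_cases hs : 1 ≤ s ^ 2 ∧ s ^ 2 ≤ 2
    · have h1 := hB s ⟨by nlinarith [hs.2], by nlinarith [hs.2]⟩
      rw [Real.norm_eq_abs] at h1
      nlinarith [sq_abs (deriv H s), abs_nonneg (deriv H s)]
    · rw [hd0 s hs]
      nlinarith [sq_nonneg B]
  refine ⟨B ^ 2 + 1, by positivity, fun M hM => ?_⟩
  have hr : 0 < √M := Real.sqrt_pos.2 hM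
  have hsq : ∀ t : ℝ, (t / √M) ^ 2 = t ^ 2 / M := fun t => by rw [div_pow, Real.sq_sqrt hM.le]
  have hder : ∀ t, deriv (fun t => H (t / √M)) t = deriv H (t / √M) / √M := by
    intro t
    have := ((hHc.differentiable one_ne_zero (t / √M)).hasDerivAt.comp t
      ((hasDerivAt_id t).div_const √M)).deriv
    simpa [Function.comp_def, div_eq_mul_inv] using this
  refine ⟨fun t => H (t / √M), hHc.comp (by fun_prop), fun t => ?_, fun t ht => hH0 _ ?_,
    fun t ht => hH1 _ ?_, fun t => ?_, fun t ht => ?_⟩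
  · rw [abs_of_nonneg (Real.smoothTransition.nonneg _)]
    exact Real.smoothTransition.le_one _
  · rw [hsq, div_le_one hM]
    exact ht
  · rw [hsq, le_div_iff₀ hM]
    exact ht
  · rw [hder, div_pow, Real.sq_sqrt hM.le]
    exact div_le_div_of_nonneg_right (hdB _) hM.le
  · rw [hder, hd0, zero_div]
    rwa [hsq, le_div_iff₀ hM, div_le_iff₀ hM, one_mul]

theorem mul_log_le_add_sum {n₀ N : ℕ} (hn₀ : 1 ≤ n₀) {u : ℝ} (hu : 0 ≤ u) (huN : u < 2 * 4 ^ N) :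
    u * Real.log u ≤ u - 1 + (4 * 4 ^ n₀ + 2) * (√u - 1) ^ 2 +
      32 * ∑ n ∈ Finset.Ico n₀ N, if 2 * 4 ^ n ≤ u then (n : ℝ) * 4 ^ n else 0 := by
  have hterm : ∀ n : ℕ, 0 ≤ if 2 * 4 ^ n ≤ u then (n : ℝ) * 4 ^ n else 0 := fun n => by
    split_ifs <;> positivity
  have hsum := Finset.sum_nonneg (s := Finset.Ico n₀ N) fun n _ => hterm n
  rcases lt_or_ge u (2 * 4 ^ n₀) with h | h
  · rcases hu.eq_or_lt with rfl | hu0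
    · norm_num
      nlinarith [pow_pos (by norm_num : (0 : ℝ) < 4) n₀]
    · have h1 := mul_le_mul_of_nonneg_left (Real.log_le_sub_one_of_pos hu0) hu
      have hs := Real.sq_sqrt hu
      set s := √u
      have h2 : (s + 1) ^ 2 ≤ 4 * 4 ^ n₀ + 2 := by nlinarith [sq_nonneg (s - 1)]
      have h3 : u * (u - 1) = u - 1 + (s + 1) ^ 2 * (s - 1) ^ 2 := by rw [← hs]; ring
      nlinarith [mul_le_mul_of_nonneg_right h2 (sq_nonneg (s - 1))]
  · have hex : ∃ n, n₀ ≤ n ∧ 2 * 4 ^ n ≤ u ∧ u < 2 * 4 ^ (n + 1) := by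
      by_contra! hne
      have hall : ∀ k, 2 * 4 ^ (n₀ + k) ≤ u := by
        intro k
        induction k with
        | zero => exact h
        | succ k ih => exact hne _ (Nat.le_add_right _ _) ih
      have h1 : (4 : ℝ) ^ N ≤ 4 ^ (n₀ + N) := pow_le_pow_right₀ (by norm_num) (by omega)
      linarith [hall N]
    obtain ⟨n, hn, h1, h2⟩ := hex
    have hnN : n < N := by
      by_contra! hc
      have h1' : (4 : ℝ) ^ N ≤ 4 ^ n := pow_le_pow_right₀ (by norm_num) hc
      linarith
    have hle := Finset.single_le_sum (f := fun n : ℕ => if 2 * 4 ^ n ≤ u then (n : ℝ) * 4 ^ n else 0)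
      (fun n _ => hterm n) (Finset.mem_Ico.2 ⟨hn, hnN⟩)
    simp only [if_pos h1] at hle
    have h4 : (1 : ℝ) ≤ 4 ^ n := one_le_pow₀ (by norm_num)
    have hu0 : 0 < u := by linarith
    have hn1 : (1 : ℝ) ≤ n := by exact_mod_cast hn₀.trans hn
    have hlog2 : Real.log 2 ≤ 0.7 := by linarith [Real.log_two_lt_d9]
    have hlog : Real.log u ≤ 4 * n := by
      have h5 : Real.log u ≤ Real.log (2 ^ (2 * n + 3)) := by
        refine Real.log_le_log hu0 (h2.le.trans (le_of_eq ?_))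
        have : (2 : ℝ) ^ (2 * n) = 4 ^ n := by rw [pow_mul]; norm_num
        rw [pow_add _ (2 * n), this]
        ring
      rw [Real.log_pow] at h5
      push_cast at h5
      nlinarith
    have h6 : u * Real.log u ≤ (8 * 4 ^ n) * (4 * n) :=
      mul_le_mul (by rw [pow_succ] at h2; linarith) hlog (Real.log_nonneg (by linarith)) (by positivity)
    have h7 : 0 ≤ (4 * (4 : ℝ) ^ n₀ + 2) * (√u - 1) ^ 2 := by positivity
    linarith

theorem integral_sq_abs_sub_le {X : Type*} [MeasurableSpace X] {ν : Measure X} [IsFiniteMeasure ν]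
    {f : X → ℝ} (hf : Integrable f ν) (hf2 : Integrable (fun x => f x ^ 2) ν) {r : ℝ} (hr : 0 < r)
    (hfr : ∫ x, f x ^ 2 ∂ν = r ^ 2 * ν.real Set.univ) (a : ℝ) :
    ∫ x, (|f x| - r) ^ 2 ∂ν ≤ 4 * ∫ x, (f x - a) ^ 2 ∂ν := by
  have key : ∀ {g : X → ℝ} (c : ℝ), Integrable g ν → (∀ x, g x ^ 2 = f x ^ 2) →
      Integrable (fun x => (g x - c) ^ 2) ν ∧ ∫ x, (g x - c) ^ 2 ∂ν =
        ∫ x, f x ^ 2 ∂ν - 2 * c * ∫ x, g x ∂ν + c ^ 2 * ν.real Set.univ := by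
    intro g c hg hgf
    have he : (fun x => (g x - c) ^ 2) = fun x => f x ^ 2 - 2 * c * g x + c ^ 2 := by
      funext x
      rw [← hgf]
      ring
    have hi : Integrable (fun x => f x ^ 2 - 2 * c * g x) ν := hf2.sub (hg.const_mul (2 * c))
    refine ⟨he ▸ hi.add (integrable_const _), ?_⟩
    rw [he, integral_add hi (integrable_const _), integral_sub hf2 (hg.const_mul _),
      integral_const_mul, integral_const, smul_eq_mul, mul_comm (ν.real _)]
  obtain ⟨hi1, he1⟩ := key r hf.abs fun x => sq_abs _
  obtain ⟨hi2, he2⟩ := key a hf fun x => rfl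
  have hA : ∫ x, |f x| ∂ν ≤ r * ν.real Set.univ := by
    have h0 : 0 ≤ ∫ x, (|f x| - r) ^ 2 ∂ν := integral_nonneg fun x => sq_nonneg _
    rw [he1, hfr] at h0
    exact le_of_mul_le_mul_left (by linarith) (by positivity : 0 < 2 * r)
  have haf : a * ∫ x, f x ∂ν ≤ |a| * (r * ν.real Set.univ) := by
    refine (le_abs_self _).trans ?_
    rw [abs_mul]
    exact mul_le_mul_of_nonneg_left (abs_integral_le_integral_abs.trans hA) (abs_nonneg a)
  have hpt : ∫ x, (|f x| - r) ^ 2 ∂ν ≤ ∫ x, (2 * (f x - a) ^ 2 + 2 * (|a| - r) ^ 2) ∂ν := by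
    refine integral_mono hi1 ((hi2.const_mul 2).add (integrable_const _)) fun x => ?_
    have h1 : f x * a ≤ |f x| * |a| := by rw [← abs_mul]; exact le_abs_self _
    have h2 := sq_abs (f x)
    have h3 := sq_abs a
    nlinarith [sq_nonneg ((|f x| - |a|) - (|a| - r))]
  rw [integral_add (hi2.const_mul 2) (integrable_const _), integral_const_mul, integral_const,
    smul_eq_mul] at hpt
  rw [hfr, ← sq_abs a] at he2
  nlinarith

theorem exists_sum_level_le {β p : ℝ} (hβ : 0 < β) (hp : 2 ≤ p) (Z : ℝ) :
    ∃ C : ℝ, ∃ n₀ : ℕ, 0 < C ∧ 1 ≤ n₀ ∧ ∀ f : (Fin 3 → ℝ) → ℝ, ContDiff ℝ 1 f → ∀ m : ℝ, 0 < m →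
      ∫⁻ x, ENNReal.ofReal (f x ^ 2) * hweight β p x ≤ ENNReal.ofReal (m * Z) → ∀ N : ℕ,
      ∑ n ∈ Finset.Ico n₀ N, ENNReal.ofReal (n * (m * 4 ^ n)) *
          ∫⁻ x in {x | 2 * (m * 4 ^ n) ≤ f x ^ 2}, hweight β p x ≤
        ENNReal.ofReal C * ∫⁻ x, ENNReal.ofReal (gradSq heisA f x) * hweight β p x := by
  obtain ⟨C, n₀, hC, hfk⟩ := exists_faberKrahn hβ hp Z
  obtain ⟨D, hD, hcut⟩ := exists_cutoff
  refine ⟨C * D, n₀ + 1, by positivity, by omega, fun f hf m hm hfin N => ?_⟩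
  have hwm : Measurable (hweight β p) := measurable_hweight (by linarith)
  have hfm : Measurable fun x => f x ^ 2 := hf.continuous.measurable.pow_const 2
  have hgm : Measurable fun x => ENNReal.ofReal (gradSq heisA f x) * hweight β p x :=
    (continuous_gradSq hf).measurable.ennreal_ofReal.mul hwm
  set A : ℕ → Set (Fin 3 → ℝ) := fun n => {x | m * 4 ^ n ≤ f x ^ 2 ∧ f x ^ 2 ≤ 2 * (m * 4 ^ n)}
    with hA
  have hAm : ∀ n, MeasurableSet (A n) := fun n =>
    (measurableSet_le measurable_const hfm).inter (measurableSet_le hfm measurable_const)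
  have hAd : Pairwise (Function.onFun Disjoint A) := by
    have : ∀ i j, i < j → Disjoint (A i) (A j) := by
      refine fun i j hij => Set.disjoint_left.2 fun x hi hj => ?_
      have h1 : (4 : ℝ) ^ (i + 1) ≤ 4 ^ j := pow_le_pow_right₀ (by norm_num) hij
      have h2 : (0 : ℝ) < m * 4 ^ i := by positivity
      have h3 := mul_le_mul_of_nonneg_left h1 hm.le
      rw [pow_succ] at h3
      linarith [hi.2, hj.1]
    intro i j hij
    rcases lt_or_gt_of_ne hij with h | h
    · exact this i j h
    · exact (this j i h).symm
  have hone : ∀ n ∈ Finset.Ico (n₀ + 1) N, ENNReal.ofReal (n * (m * 4 ^ n)) *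
      ∫⁻ x in {x | 2 * (m * 4 ^ n) ≤ f x ^ 2}, hweight β p x ≤
      ENNReal.ofReal (C * D) *
        ∫⁻ x in A n, ENNReal.ofReal (gradSq heisA f x) * hweight β p x := by
    intro n hn
    have hn0 : n₀ ≤ n := by have := (Finset.mem_Ico.1 hn).1; omega
    set M : ℝ := m * 4 ^ n with hM
    have hM0 : 0 < M := by positivity
    obtain ⟨h, hhc, hh1, hh0, hhM, hhd, hhd0⟩ := hcut M hM0
    have hle : ∀ x, ENNReal.ofReal (h (f x) ^ 2) * hweight β p x ≤ hweight β p x := by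
      intro x
      refine mul_le_of_le_one_left zero_le (ENNReal.ofReal_le_one.2 ?_)
      rw [← sq_abs]
      exact pow_le_one₀ (abs_nonneg _) (hh1 _)
    have hsupp : ∫⁻ x in {x | h (f x) ≠ 0}, hweight β p x ≤ ENNReal.ofReal ((1 / 4) ^ n * Z) := by
      have hsub : {x | h (f x) ≠ 0} ⊆ {x | M ≤ f x ^ 2} := by
        intro x hx
        by_contra! hc
        exact hx (hh0 _ (not_le.1 hc).le)
      have hMm : MeasurableSet {x | M ≤ f x ^ 2} := measurableSet_le measurable_const hfm
      refine (lintegral_mono_set hsub).trans ?_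
      rw [← ENNReal.mul_le_mul_iff_right (ENNReal.ofReal_pos.2 hM0).ne' ENNReal.ofReal_ne_top,
        ← lintegral_const_mul _ hwm, ← ENNReal.ofReal_mul hM0.le]
      have he : M * ((1 / 4) ^ n * Z) = m * Z := by
        rw [hM, mul_assoc m, ← mul_assoc (4 ^ n : ℝ), ← mul_pow]
        norm_num
      rw [he]
      refine le_trans ?_ hfin
      refine (setLIntegral_mono' hMm fun x hx => ?_).trans (setLIntegral_le_lintegral _ _)
      exact mul_le_mul_left (ENNReal.ofReal_le_ofReal hx) _
    have hmain := hfk n hn0 (fun x => h (f x)) (hhc.comp hf)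
      (ne_top_of_le_ne_top (lintegral_hweight_ne_top hβ (by linarith)) (lintegral_mono hle)) hsupp
    have hlow : ∫⁻ x in {x | 2 * M ≤ f x ^ 2}, hweight β p x ≤
        ∫⁻ x, ENNReal.ofReal (h (f x) ^ 2) * hweight β p x := by
      refine (setLIntegral_mono' (measurableSet_le measurable_const hfm) fun x hx => ?_).trans
        (setLIntegral_le_lintegral _ _)
      rw [hhM _ hx]
      simp
    have hgrad : ∫⁻ x, ENNReal.ofReal (gradSq heisA (fun x => h (f x)) x) * hweight β p x ≤
        ENNReal.ofReal (D / M) *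
          ∫⁻ x in A n, ENNReal.ofReal (gradSq heisA f x) * hweight β p x := by
      rw [← lintegral_indicator (hAm n), ← lintegral_const_mul _ (hgm.indicator (hAm n))]
      refine lintegral_mono fun x => ?_
      rw [gradSq_comp hhc hf]
      by_cases hx : x ∈ A n
      · rw [Set.indicator_of_mem hx, ← mul_assoc, ← ENNReal.ofReal_mul (by positivity)]
        exact mul_le_mul_left (ENNReal.ofReal_le_ofReal
          (mul_le_mul_of_nonneg_right (hhd _) (gradSq_nonneg _ _ _))) _
      · rw [hhd0 _ hx]
        simp
    calc ENNReal.ofReal (n * M) * ∫⁻ x in {x | 2 * M ≤ f x ^ 2}, hweight β p x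
        ≤ ENNReal.ofReal M *
          (n * ∫⁻ x, ENNReal.ofReal (h (f x) ^ 2) * hweight β p x) := by
          rw [mul_comm (n : ℝ), ENNReal.ofReal_mul hM0.le, ENNReal.ofReal_natCast, mul_assoc]
          exact mul_le_mul_right (mul_le_mul_right hlow _) _
      _ ≤ ENNReal.ofReal M * (ENNReal.ofReal C * (ENNReal.ofReal (D / M) *
          ∫⁻ x in A n, ENNReal.ofReal (gradSq heisA f x) * hweight β p x)) :=
          mul_le_mul_right (hmain.trans (mul_le_mul_right hgrad _)) _
      _ = _ := by
          rw [← mul_assoc, ← mul_assoc, ← ENNReal.ofReal_mul hM0.le,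
            ← ENNReal.ofReal_mul (by positivity)]
          congr 2
          field_simp
  calc _ ≤ ∑ n ∈ Finset.Ico (n₀ + 1) N, ENNReal.ofReal (C * D) *
        ∫⁻ x in A n, ENNReal.ofReal (gradSq heisA f x) * hweight β p x := Finset.sum_le_sum hone
    _ = ENNReal.ofReal (C * D) * ∫⁻ x in ⋃ n ∈ Finset.Ico (n₀ + 1) N, A n,
        ENNReal.ofReal (gradSq heisA f x) * hweight β p x := by
        rw [← Finset.mul_sum, lintegral_biUnion_finset (fun i _ j _ hij => hAd hij)
          (fun n _ => hAm n)]
    _ ≤ _ := mul_le_mul_right (setLIntegral_le_lintegral _ _) _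

/-- The unnormalised Gibbs measure `e^{-β d^p} dx`. -/
def heisGibbs (β p : ℝ) : Measure (Fin 3 → ℝ) :=
  volume.withDensity (hweight β p)

theorem lintegral_heisGibbs {β p : ℝ} (hp : 0 ≤ p) {g : (Fin 3 → ℝ) → ENNReal}
    (hg : Measurable g) : ∫⁻ x, g x ∂heisGibbs β p = ∫⁻ x, g x * hweight β p x := by
  rw [heisGibbs, lintegral_withDensity_eq_lintegral_mul _ (measurable_hweight hp) hg]
  exact lintegral_congr fun x => mul_comm _ _

theorem integral_heisGibbs {β p : ℝ} (hp : 0 ≤ p) (g : (Fin 3 → ℝ) → ℝ) :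
    ∫ x, g x ∂heisGibbs β p = ∫ x, g x * Real.exp (-(β * dH x ^ p)) := by
  rw [heisGibbs, integral_withDensity_eq_integral_toReal_smul (measurable_hweight hp)
    (ae_of_all _ fun x => ENNReal.ofReal_lt_top)]
  refine integral_congr_ae (ae_of_all _ fun x => ?_)
  simp only [hweight, ENNReal.toReal_ofReal (Real.exp_pos _).le, smul_eq_mul]
  exact mul_comm _ _

theorem isFiniteMeasure_heisGibbs {β p : ℝ} (hβ : 0 < β) (hp : 1 ≤ p) :
    IsFiniteMeasure (heisGibbs β p) :=
  isFiniteMeasure_withDensity (lintegral_hweight_ne_top hβ hp)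

theorem heisGibbs_real_univ_pos {β p : ℝ} (hβ : 0 < β) (hp : 1 ≤ p) :
    0 < (heisGibbs β p).real Set.univ := by
  have := isFiniteMeasure_heisGibbs hβ hp
  refine ENNReal.toReal_pos (fun h => ?_) (measure_ne_top _ _)
  rw [heisGibbs, withDensity_apply _ MeasurableSet.univ, setLIntegral_univ,
    lintegral_eq_zero_iff (measurable_hweight (by linarith))] at h
  have h1 : ∀ᵐ x : Fin 3 → ℝ, False := h.mono fun x hx => by
    simp only [hweight, Pi.zero_apply, ENNReal.ofReal_eq_zero, not_le.2 (Real.exp_pos _)] at hx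
  exact NeZero.ne (volume : Measure (Fin 3 → ℝ)) (by simpa using h1)

theorem gibbsInt_eq_integral_heisGibbs {β p : ℝ} (hp : 0 ≤ p) (g : (Fin 3 → ℝ) → ℝ) :
    gibbsInt (fun x => β * dH x ^ p) g =
      (∫ x, g x ∂heisGibbs β p) / (heisGibbs β p).real Set.univ := by
  have h1 := integral_heisGibbs (β := β) hp fun _ => (1 : ℝ)
  rw [integral_const, smul_eq_mul, mul_one] at h1
  simp only [one_mul] at h1
  rw [gibbsInt, integral_heisGibbs hp, h1]

theorem sq_mul_log_div_le_add_sum {n₀ N : ℕ} (hn₀ : 1 ≤ n₀) {m s : ℝ} (hm : 0 < m)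
    (hs : s ^ 2 / m < 2 * 4 ^ N) :
    s ^ 2 * Real.log (s ^ 2 / m) ≤ (s ^ 2 - m + (4 * 4 ^ n₀ + 2) * (|s| - √m) ^ 2) +
      32 * ∑ n ∈ Finset.Ico n₀ N, if 2 * (m * 4 ^ n) ≤ s ^ 2 then (n : ℝ) * (m * 4 ^ n) else 0 := by
  have h1 := mul_le_mul_of_nonneg_left
    (mul_log_le_add_sum hn₀ (div_nonneg (sq_nonneg s) hm.le) hs) hm.le
  have h2 : m * (√(s ^ 2 / m) - 1) ^ 2 = (|s| - √m) ^ 2 := by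
    have hr0 : 0 < √m := Real.sqrt_pos.2 hm
    rw [Real.sqrt_div (sq_nonneg _), Real.sqrt_sq_eq_abs]
    nth_rewrite 1 [← Real.sq_sqrt hm.le]
    field_simp
  have h3 : m * (s ^ 2 / m) = s ^ 2 := by field_simp
  have h4 : m * ∑ n ∈ Finset.Ico n₀ N, (if 2 * 4 ^ n ≤ s ^ 2 / m then (n : ℝ) * 4 ^ n else 0) =
      ∑ n ∈ Finset.Ico n₀ N, if 2 * (m * 4 ^ n) ≤ s ^ 2 then (n : ℝ) * (m * 4 ^ n) else 0 := by
    rw [Finset.mul_sum]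
    refine Finset.sum_congr rfl fun n _ => ?_
    have hiff : 2 * 4 ^ n ≤ s ^ 2 / m ↔ 2 * (m * 4 ^ n) ≤ s ^ 2 := by
      rw [le_div_iff₀ hm, mul_assoc 2, mul_comm _ m]
    rw [mul_ite, mul_zero, mul_left_comm]
    exact if_congr hiff rfl rfl
  rw [← mul_assoc, h3] at h1
  refine h1.trans (le_of_eq ?_)
  linear_combination h3 + (4 * 4 ^ n₀ + 2) * h2 + 32 * h4

theorem exists_logSobolev_heisGibbs {β p : ℝ} (hβ : 0 < β) (hp : 2 ≤ p) :
    ∃ c : ℝ, 0 < c ∧ ∀ f : (Fin 3 → ℝ) → ℝ, ContDiff ℝ 1 f → HasCompactSupport f →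
      ∀ m : ℝ, 0 < m → ∫ x, f x ^ 2 ∂heisGibbs β p = m * (heisGibbs β p).real Set.univ →
      ∫ x, f x ^ 2 * Real.log (f x ^ 2 / m) ∂heisGibbs β p ≤
        c * ∫ x, gradSq heisA f x ∂heisGibbs β p := by
  have hp0 : 0 ≤ p := by linarith
  have hfinite := isFiniteMeasure_heisGibbs hβ (by linarith : 1 ≤ p)
  set ν := heisGibbs β p with hν
  obtain ⟨C₁, hC₁, hpoin⟩ := exists_poincare hβ hp
  obtain ⟨C₂, n₀, hC₂, hn₀, hlevel⟩ := exists_sum_level_le hβ hp (ν.real Set.univ)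
  set K : ℝ := 4 * 4 ^ n₀ + 2 with hK
  have hK0 : 0 < K := by positivity
  refine ⟨K * (4 * C₁) + 32 * C₂, by positivity, fun f hf hfc m hm hfm => ?_⟩
  have hInt : ∀ g : (Fin 3 → ℝ) → ℝ, Continuous g → HasCompactSupport g → Integrable g ν :=
    fun g hg hgc => hg.integrable_of_hasCompactSupport hgc
  have hf1 := hInt f hf.continuous hfc
  have hf2c : HasCompactSupport fun x => f x ^ 2 :=
    hfc.comp_left (g := fun t : ℝ => t ^ 2) (by simp)
  have hf2 : Integrable (fun x => f x ^ 2) ν := hInt _ (hf.continuous.pow 2) hf2c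
  have hgc : HasCompactSupport (gradSq heisA f) := by
    refine (hfc.fderiv ℝ).mono fun x hx hx0 => hx ?_
    simp [gradSq, xop_eq_fderiv, hx0]
  have hg := hInt _ (continuous_gradSq hf) hgc
  set G := ∫ x, gradSq heisA f x ∂ν with hG
  have hG0 : 0 ≤ G := integral_nonneg fun x => gradSq_nonneg _ _ _
  have hto : ∀ g : (Fin 3 → ℝ) → ℝ, Measurable g → (∀ x, 0 ≤ g x) → Integrable g ν →
      ∫⁻ x, ENNReal.ofReal (g x) * hweight β p x = ENNReal.ofReal (∫ x, g x ∂ν) := by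
    intro g hgm hg0 hgi
    rw [← lintegral_heisGibbs hp0 hgm.ennreal_ofReal,
      ofReal_integral_eq_lintegral_ofReal hgi (ae_of_all _ hg0)]
  have hGl := hto _ (continuous_gradSq hf).measurable (gradSq_nonneg _ _) hg
  have hf2l := hto _ (hf.continuous.measurable.pow_const 2) (fun x => sq_nonneg _) hf2
  set r := √m with hr
  have hr0 : 0 < r := Real.sqrt_pos.2 hm
  have hrm : r ^ 2 = m := Real.sq_sqrt hm.le
  have hfirst : ∫ x, (|f x| - r) ^ 2 ∂ν ≤ 4 * C₁ * G := by
    obtain ⟨a, ha⟩ := hpoin f hf (by rw [hf2l]; exact ENNReal.ofReal_ne_top)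
    have hia : Integrable (fun x => (f x - a) ^ 2) ν := by
      have he : (fun x => (f x - a) ^ 2) = fun x => f x ^ 2 - 2 * a * f x + a ^ 2 := by
        funext x
        ring
      rw [he]
      exact (hf2.sub (hf1.const_mul (2 * a))).add (integrable_const _)
    rw [hto _ ((hf.continuous.measurable.sub_const a).pow_const 2) (fun x => sq_nonneg _) hia,
      hGl, ← ENNReal.ofReal_mul hC₁.le, ENNReal.ofReal_le_ofReal_iff (by positivity)] at ha
    have := integral_sq_abs_sub_le hf1 hf2 hr0 (by rw [hfm, hrm]) a
    linarith
  obtain ⟨B, hB⟩ := hfc.exists_bound_of_continuous hf.continuous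
  obtain ⟨N, hN⟩ := pow_unbounded_of_one_lt (B ^ 2 / m) (by norm_num : (1 : ℝ) < 4)
  set S : ℕ → Set (Fin 3 → ℝ) := fun n => {x | 2 * (m * 4 ^ n) ≤ f x ^ 2} with hS
  have hSm : ∀ n, MeasurableSet (S n) := fun n =>
    measurableSet_le measurable_const (hf.continuous.measurable.pow_const 2)
  have hsecond : ∑ n ∈ Finset.Ico n₀ N, n * (m * 4 ^ n) * ν.real (S n) ≤ C₂ * G := by
    have h1 := hlevel f hf m hm (by rw [hf2l, hfm]) N
    rw [hGl, ← ENNReal.ofReal_mul hC₂.le] at h1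
    rw [← ENNReal.ofReal_le_ofReal_iff (by positivity),
      ENNReal.ofReal_sum_of_nonneg fun n _ => by positivity]
    refine le_trans (Finset.sum_le_sum fun n _ => ?_) h1
    rw [ENNReal.ofReal_mul (by positivity), ofReal_measureReal, hν, heisGibbs,
      withDensity_apply _ (hSm n)]
  have hpt : ∀ x, f x ^ 2 * Real.log (f x ^ 2 / m) ≤ (f x ^ 2 - m + K * (|f x| - r) ^ 2) +
      32 * ∑ n ∈ Finset.Ico n₀ N, (S n).indicator (fun _ => (n : ℝ) * (m * 4 ^ n)) x := by
    intro x
    have hu : f x ^ 2 / m < 2 * 4 ^ N := by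
      have h1 : f x ^ 2 / m ≤ B ^ 2 / m := by
        refine div_le_div_of_nonneg_right ?_ hm.le
        rw [← sq_abs]
        exact pow_le_pow_left₀ (abs_nonneg _) (hB x) 2
      linarith [pow_pos (by norm_num : (0 : ℝ) < 4) N]
    rw [hr]
    refine (sq_mul_log_div_le_add_sum hn₀ hm hu).trans (le_of_eq ?_)
    simp only [Set.indicator_apply, hS, Set.mem_ofPred_eq, hK]
  have hir : Integrable (fun x => (|f x| - r) ^ 2) ν := by
    have he : (fun x => (|f x| - r) ^ 2) = fun x => f x ^ 2 - 2 * r * |f x| + r ^ 2 := by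
      funext x
      rw [← sq_abs (f x)]
      ring
    rw [he]
    exact (hf2.sub (hf1.abs.const_mul (2 * r))).add (integrable_const _)
  have hiS : ∀ n ∈ Finset.Ico n₀ N,
      Integrable (fun x => (S n).indicator (fun _ => (n : ℝ) * (m * 4 ^ n)) x) ν :=
    fun n _ => (integrable_const _).indicator (hSm n)
  have hi1 : Integrable (fun x => f x ^ 2 - m) ν := hf2.sub (integrable_const _)
  have hi2 : Integrable (fun x => f x ^ 2 - m + K * (|f x| - r) ^ 2) ν :=
    hi1.add (hir.const_mul K)
  have hi3 := (integrable_finsetSum _ hiS).const_mul 32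
  have hiL : Integrable (fun x => f x ^ 2 * Real.log (f x ^ 2 / m)) ν := by
    have he : (fun x => f x ^ 2 * Real.log (f x ^ 2 / m)) =
        fun x => m * (f x ^ 2 / m * Real.log (f x ^ 2 / m)) := by
      funext x
      field_simp
    rw [he]
    exact hInt _ (continuous_const.mul (Real.continuous_mul_log.comp
        ((hf.continuous.pow 2).div_const m)))
      (hfc.comp_left (g := fun t : ℝ => m * (t ^ 2 / m * Real.log (t ^ 2 / m))) (by simp))
  have hle := integral_mono hiL (hi2.add hi3) hpt
  have he1 : ∫ x, (f x ^ 2 - m + K * (|f x| - r) ^ 2) ∂ν = K * ∫ x, (|f x| - r) ^ 2 ∂ν := by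
    rw [integral_add hi1 (hir.const_mul K), integral_sub hf2 (integrable_const _), integral_const,
      hfm, integral_const_mul, smul_eq_mul, mul_comm m, sub_self, zero_add]
  have he2 : ∫ x, (32 * ∑ n ∈ Finset.Ico n₀ N,
      (S n).indicator (fun _ => (n : ℝ) * (m * 4 ^ n)) x) ∂ν =
      32 * ∑ n ∈ Finset.Ico n₀ N, n * (m * 4 ^ n) * ν.real (S n) := by
    rw [integral_const_mul, integral_finsetSum _ hiS]
    congr 1
    refine Finset.sum_congr rfl fun n _ => ?_
    rw [integral_indicator_const _ (hSm n), smul_eq_mul, mul_comm]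
  have hsplit := integral_add hi2 hi3
  rw [he1, he2] at hsplit
  have h1 := mul_le_mul_of_nonneg_left hfirst hK0.le
  have h2 : (∫ x, f x ^ 2 * Real.log (f x ^ 2 / m) ∂ν) ≤ _ := hle.trans_eq hsplit
  linarith

/-- the Hebisch–Zegarliński result recalled in Section 1.2 of the paper:
for every real `p ≥ 2` and `β > 0` the measure `μ_p = e^{-β d^p} dx / Z` on the Heisenberg
group `ℍ₁` satisfies a log-Sobolev inequality. -/
theorem heisenberg_mu_p_logSobolev :
    ∀ p β : ℝ, 2 ≤ p → 0 < β →
      ∃ c : ℝ, 0 < c ∧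
        ∀ f : (Fin 3 → ℝ) → ℝ, ContDiff ℝ (⊤ : ℕ∞) f → HasCompactSupport f →
          gibbsInt (fun x => β * dH x ^ p)
              (fun x => f x ^ 2 *
                Real.log (f x ^ 2 / gibbsInt (fun z => β * dH z ^ p) fun y => f y ^ 2)) ≤
            c * gibbsInt (fun x => β * dH x ^ p) (fun x => gradSq heisA f x) := by
  intro p β hp hβ
  obtain ⟨c, hc, h⟩ := exists_logSobolev_heisGibbs hβ hp
  refine ⟨c, hc, fun f hf hfc => ?_⟩
  have hf1 : ContDiff ℝ 1 f := hf.of_le (by exact_mod_cast le_top)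
  have hp0 : 0 ≤ p := by linarith
  have hZ := heisGibbs_real_univ_pos hβ (by linarith : 1 ≤ p)
  simp only [gibbsInt_eq_integral_heisGibbs hp0]
  rw [← mul_div_assoc]
  refine div_le_div_of_nonneg_right ?_ hZ.le
  rcases (integral_nonneg fun x => sq_nonneg (f x) :
    0 ≤ ∫ x, f x ^ 2 ∂heisGibbs β p).eq_or_lt with h0 | h0
  · rw [← h0]
    simpa using mul_nonneg hc.le (integral_nonneg fun x => gradSq_nonneg heisA f x)
  · exact h f hf1 hfc _ (div_pos h0 hZ) (by field_simp)
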